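/- Fix n, m ≥ 1 and λ, ν ∈ Sig_n. For each μ ∈ Sig_{2n}^+, let (c_{μ,ν}^{alt,κ}(t))_{κ ∈ Sig_n} be the unique finitely supported family in ℤ[t] with P_μ(x_1, x_1 t, …, x_n, x_n t; t) · P_ν(x_1,…,x_n; t²) = ∑_{κ ∈ Sig_n} c_{μ,ν}^{alt,κ}(t) · P_κ(x_1,…,x_n; t²). Then ∑_{μ ∈ Sig_{2n}^+} c_{μ,ν}^{alt,λ}(t) · Q_{μ/0[2n]}(x_1,…,x_m; t) = Q_{λ/ν}(x_1,…,x_m; t²), as an identity of Laurent polynomials in x_1,…,x_m with coefficients in ℤ[t]; only finitely many summands are nonzero, since c_{μ,ν}^{alt,λ} = 0 unless |μ| = |λ| − |ν|. -/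

import Mathlib

open scoped Classical

noncomputable section

/-- Sum of the parts of an integer tuple. -/
def sumz {p : ℕ} (l : Fin p → ℤ) : ℤ := ∑ i, l i

/-- `mcount l c = m_c(l)`, the number of parts of `l` equal to `c`. -/
def mcount {p : ℕ} (l : Fin p → ℤ) (c : ℤ) : ℕ := (Finset.univ.filter fun j => l j = c).card

/-- `l` is a signature: its parts are weakly decreasing. -/
def IsSig {p : ℕ} (l : Fin p → ℤ) : Prop := ∀ i j : Fin p, i ≤ j → l j ≤ l i

/-- `μ ≺_P l`: `l i ≥ μ i ≥ l (i+1)` for all `i`. -/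
def interP {m : ℕ} (μ : Fin m → ℤ) (l : Fin (m + 1) → ℤ) : Prop :=
  ∀ i : Fin m, μ i ≤ l i.castSucc ∧ l i.succ ≤ μ i

/-- `ν ≺_Q l`: `l i ≥ ν i` for all `i`, and `ν i ≥ l (i+1)`. -/
def interQ {n : ℕ} (ν l : Fin n → ℤ) : Prop :=
  (∀ i, ν i ≤ l i) ∧ ∀ i j : Fin n, (j : ℕ) = (i : ℕ) + 1 → l j ≤ ν i

/-- `ψ_{l/μ}(t) = ∏_{i : m_i(μ) = m_i(l) + 1} (1 − t^{m_i(μ)})`. -/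
def psiHL {K : Type} [Field K] {p : ℕ} (t : K) (l : Fin (p + 1) → ℤ) (μ : Fin p → ℤ) : K :=
  ∏ᶠ c : ℤ, if mcount μ c = mcount l c + 1 then 1 - t ^ mcount μ c else 1

/-- `φ_{l/ν}(t) = ∏_{i : m_i(l) = m_i(ν) + 1} (1 − t^{m_i(l)})`. -/
def phiHL {K : Type} [Field K] {p : ℕ} (t : K) (l ν : Fin p → ℤ) : K :=
  ∏ᶠ c : ℤ, if mcount l c = mcount ν c + 1 then 1 - t ^ mcount l c else 1

/-- Skew Hall–Littlewood polynomial `P_{l/μ}(x₁,…,x_k;t)`, via the branching rule, as a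
function of `x : Fin k → K`. -/
def HLP {K : Type} [Field K] {m : ℕ} (t : K) :
    (k : ℕ) → (Fin m → ℤ) → (Fin (m + k) → ℤ) → (Fin k → K) → K
  | 0, μ, l, _ => if μ = l then 1 else 0
  | k + 1, μ, l, x =>
    ∑ᶠ ν : Fin (m + k) → ℤ,
      if interP ν l then
        psiHL t l ν * x (Fin.last k) ^ (sumz l - sumz ν) * HLP t k μ ν fun i => x i.castSucc
      else 0

/-- Skew Hall–Littlewood polynomial `Q_{l/ν}(x₁,…,x_k;t)` (`ν` and `l` both of length `n`),
via the branching rule, as a function of `x : Fin k → K`. -/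
def HLQ {K : Type} [Field K] {n : ℕ} (t : K) :
    (k : ℕ) → (Fin n → ℤ) → (Fin n → ℤ) → (Fin k → K) → K
  | 0, ν, l, _ => if ν = l then 1 else 0
  | k + 1, ν, l, x =>
    ∑ᶠ κ : Fin n → ℤ,
      if interQ κ l then
        phiHL t l κ * x (Fin.last k) ^ (sumz l - sumz κ) * HLQ t k ν κ fun i => x i.castSucc
      else 0

/-- The (non-skew) Hall–Littlewood polynomial `P_l(x₁,…,x_n;t) = P_{l/∅}(x₁,…,x_n;t)`. -/
def HLPfull {K : Type} [Field K] {n : ℕ} (t : K) (l : Fin n → ℤ) (x : Fin n → K) : K :=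
  HLP t n (fun i : Fin 0 => 0) (fun i => l (Fin.cast (Nat.zero_add n) i)) x

/-- `poch t m = (t;t)_m = ∏_{j=1}^m (1 − t^j)`. -/
def poch {K : Type} [Field K] (t : K) (m : ℕ) : K := ∏ j ∈ Finset.range m, (1 - t ^ (j + 1))


/-- The list `(x₁, x₁t, x₂, x₂t, …, x_n, x_n t)` of `2n` values. -/
def doubleList {K : Type} [Field K] {n : ℕ} (t : K) (x : Fin n → K) : Fin (2 * n) → K :=
  fun i => x ⟨i.val / 2, by have := i.isLt; omega⟩ * t ^ (i.val % 2)

/-- `c` is a finitely supported family of polynomials in `ℤ[t]`, supported on signatures, with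
`P_μ(x₁, x₁t, …, x_n, x_n t; t) · P_ν(x₁,…,x_n; t²) = ∑_λ c_λ(t) · P_λ(x₁,…,x_n; t²)` as
Laurent polynomials (formalized as holding over every field at nonzero arguments). -/
def altExpand (n : ℕ) (μ : Fin (2 * n) → ℤ) (ν : Fin n → ℤ)
    (c : (Fin n → ℤ) → Polynomial ℤ) : Prop :=
  {l : Fin n → ℤ | c l ≠ 0}.Finite ∧ (∀ l, c l ≠ 0 → IsSig l) ∧
  ∀ (K : Type) [Field K] (t : K) (x : Fin n → K), (∀ i, x i ≠ 0) →
    HLPfull t μ (doubleList t x) * HLPfull (t ^ 2) ν x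
      = ∑ᶠ l : Fin n → ℤ, Polynomial.aeval t (c l) * HLPfull (t ^ 2) l x

/-- Conjugate: the number of parts `≥ c`. -/
def cj {p : ℕ} (l : Fin p → ℤ) (c : ℤ) : ℕ := (Finset.univ.filter fun i => c ≤ l i).card

lemma lt_cj_iff {p : ℕ} {l : Fin p → ℤ} (hl : IsSig l) (i : Fin p) (c : ℤ) :
    (i : ℕ) < cj l c ↔ c ≤ l i := by
  constructor
  · intro h
    by_contra hc
    have hsub : (Finset.univ.filter fun i => c ≤ l i) ⊆ Finset.Iio i := by
      intro j hj
      simp only [Finset.mem_filter, Finset.mem_univ, true_and] at hj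
      rw [Finset.mem_Iio]
      by_contra hji
      have := hl i j (not_lt.mp hji)
      omega
    have := Finset.card_le_card hsub
    rw [Fin.card_Iio] at this
    unfold cj at h
    omega
  · intro h
    have hsub : Finset.Iic i ⊆ (Finset.univ.filter fun i => c ≤ l i) := by
      intro j hj
      simp only [Finset.mem_filter, Finset.mem_univ, true_and]
      rw [Finset.mem_Iic] at hj
      have := hl j i hj
      omega
    have := Finset.card_le_card hsub
    rw [Fin.card_Iic] at this
    unfold cj
    omega

lemma cj_le {p : ℕ} (l : Fin p → ℤ) (c : ℤ) : cj l c ≤ p := by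
  unfold cj
  exact (Finset.card_le_univ _).trans (by simp)

lemma cj_anti {p : ℕ} (l : Fin p → ℤ) {c d : ℤ} (h : c ≤ d) : cj l d ≤ cj l c := by
  unfold cj
  apply Finset.card_le_card
  intro j hj
  simp only [Finset.mem_filter, Finset.mem_univ, true_and] at *
  omega

lemma mcount_add_cj {p : ℕ} (l : Fin p → ℤ) (c : ℤ) : mcount l c + cj l (c + 1) = cj l c := by
  unfold mcount cj
  rw [← Finset.card_union_of_disjoint]
  · congr 1
    ext j
    simp only [Finset.mem_union, Finset.mem_filter, Finset.mem_univ, true_and]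
    omega
  · rw [Finset.disjoint_filter]
    intro j _ h
    omega

lemma cj_bot {p : ℕ} (l : Fin p → ℤ) (c : ℤ) (h : ∀ i, c ≤ l i) : cj l c = p := by
  unfold cj
  rw [Finset.filter_true_of_mem (fun i _ => h i)]
  simp

lemma cj_top {p : ℕ} (l : Fin p → ℤ) (c : ℤ) (h : ∀ i, l i < c) : cj l c = 0 := by
  unfold cj
  rw [Finset.card_eq_zero, Finset.filter_eq_empty_iff]
  intro i _
  have := h i
  omega

lemma cj_eq_zero {p : ℕ} (l : Fin p → ℤ) (c : ℤ) (h : cj l c = 0) (i : Fin p) : l i < c := by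
  unfold cj at h
  rw [Finset.card_eq_zero, Finset.filter_eq_empty_iff] at h
  have := h (Finset.mem_univ i)
  omega

lemma mcount_zero_of_lt {p : ℕ} (l : Fin p → ℤ) (c : ℤ) (h : ∀ i, l i ≠ c) : mcount l c = 0 := by
  unfold mcount
  rw [Finset.card_eq_zero, Finset.filter_eq_empty_iff]
  intro i _
  exact h i

lemma sumz_eq_cj {p : ℕ} (l : Fin p → ℤ) (c0 : ℤ) (k : ℕ)
    (h1 : ∀ i, c0 ≤ l i) (h2 : ∀ i, l i ≤ c0 + k) :
    sumz l = p * c0 + ∑ j : Fin k, (cj l (c0 + ((j : ℕ) + 1 : ℕ)) : ℤ) := by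
  have key : ∀ i, l i = c0 + ∑ j : Fin k, (if c0 + (((j : ℕ) + 1 : ℕ) : ℤ) ≤ l i then (1 : ℤ) else 0) := by
    intro i
    have : ∑ j : Fin k, (if c0 + (((j : ℕ) + 1 : ℕ) : ℤ) ≤ l i then (1 : ℤ) else 0)
        = ((l i - c0).toNat : ℤ) := by
      rw [Fin.sum_univ_eq_sum_range
        (fun j => (if c0 + ((j + 1 : ℕ) : ℤ) ≤ l i then (1 : ℤ) else 0)) k]
      rw [Finset.sum_ite, Finset.sum_const_zero, add_zero, Finset.sum_const, nsmul_eq_mul, mul_one]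
      congr 1
      have : (Finset.range k).filter (fun j => c0 + ((j + 1 : ℕ) : ℤ) ≤ l i)
          = Finset.range (l i - c0).toNat := by
        ext j
        simp only [Finset.mem_filter, Finset.mem_range]
        have a := h1 i
        have b := h2 i
        omega
      rw [this, Finset.card_range]
    rw [this]
    have a := h1 i
    omega
  unfold sumz
  rw [Finset.sum_congr rfl (fun i _ => key i), Finset.sum_add_distrib, Finset.sum_comm]
  congr 1
  · simp
  · apply Finset.sum_congr rfl
    intro j _
    unfold cj
    rw [Finset.sum_ite, Finset.sum_const_zero, add_zero, Finset.sum_const, nsmul_eq_mul, mul_one]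

lemma interP_iff {p : ℕ} {u : Fin p → ℤ} {l : Fin (p + 1) → ℤ} (hu : IsSig u) (hl : IsSig l) :
    interP u l ↔ ∀ c, cj u c ≤ cj l c ∧ cj l c ≤ cj u c + 1 := by
  constructor
  · intro h c
    constructor
    · by_contra hc
      push Not at hc
      have hb := cj_le u c
      have a := (lt_cj_iff hu ⟨cj l c, by omega⟩ c).1 hc
      have b := (h ⟨cj l c, by omega⟩).1
      have d := (lt_cj_iff hl (Fin.castSucc ⟨cj l c, by omega⟩) c).2 (by omega)
      simp at d
    · by_contra hc
      push Not at hc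
      have hb := cj_le l c
      have a := (lt_cj_iff hl (Fin.succ ⟨cj u c, by omega⟩) c).1 (by simpa using hc)
      have b := (h ⟨cj u c, by omega⟩).2
      have d := (lt_cj_iff hu ⟨cj u c, by omega⟩ c).2 (by omega)
      simp at d
  · intro h i
    constructor
    · have a := (lt_cj_iff hu i (u i)).2 le_rfl
      have b := (h (u i)).1
      exact (lt_cj_iff hl i.castSucc (u i)).1 (by simp; omega)
    · have a := (lt_cj_iff hl i.succ (l i.succ)).2 le_rfl
      have b := (h (l i.succ)).2
      simp at a
      exact (lt_cj_iff hu i (l i.succ)).1 (by omega)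

lemma interQ_iff {p : ℕ} {u l : Fin p → ℤ} (hu : IsSig u) (hl : IsSig l) :
    interQ u l ↔ ∀ c, cj u c ≤ cj l c ∧ cj l c ≤ cj u c + 1 := by
  constructor
  · intro h c
    constructor
    · by_contra hc
      push Not at hc
      have hb := cj_le u c
      have a := (lt_cj_iff hu ⟨cj l c, by omega⟩ c).1 hc
      have b := h.1 ⟨cj l c, by omega⟩
      have d := (lt_cj_iff hl ⟨cj l c, by omega⟩ c).2 (by omega)
      simp at d
    · by_contra hc
      push Not at hc
      have hb := cj_le l c
      have a := (lt_cj_iff hl ⟨cj u c + 1, by omega⟩ c).1 (by simpa using hc)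
      have b := h.2 ⟨cj u c, by omega⟩ ⟨cj u c + 1, by omega⟩ rfl
      have d := (lt_cj_iff hu ⟨cj u c, by omega⟩ c).2 (by omega)
      simp at d
  · intro h
    constructor
    · intro i
      have a := (lt_cj_iff hu i (u i)).2 le_rfl
      have b := (h (u i)).1
      exact (lt_cj_iff hl i (u i)).1 (by omega)
    · intro i j hij
      have a := (lt_cj_iff hl j (l j)).2 le_rfl
      have b := (h (l j)).2
      exact (lt_cj_iff hu i (l j)).1 (by omega)

lemma isSig_of_step {p : ℕ} {u : Fin p → ℤ}
    (h : ∀ i j : Fin p, (j : ℕ) = (i : ℕ) + 1 → u j ≤ u i) : IsSig u := by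
  have key : ∀ d : ℕ, ∀ i j : Fin p, (j : ℕ) = (i : ℕ) + d → u j ≤ u i := by
    intro d
    induction d with
    | zero =>
      intro i j hij
      have : j = i := Fin.ext (by omega)
      rw [this]
    | succ d ih =>
      intro i j hij
      have a := ih i ⟨i + d, by omega⟩ rfl
      have b := h ⟨i + d, by omega⟩ j (by simp; omega)
      omega
  intro i j hij
  exact key (j - i) i j (by have : (i : ℕ) ≤ j := hij; omega)

lemma interP_sig {p : ℕ} {u : Fin p → ℤ} {l : Fin (p + 1) → ℤ} (h : interP u l) : IsSig u := by
  apply isSig_of_step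
  intro i j hij
  have a := (h i).2
  have b := (h j).1
  have e : i.succ = j.castSucc := Fin.ext (by simp; omega)
  rw [e] at a
  omega

lemma interQ_sig_left {p : ℕ} {u l : Fin p → ℤ} (h : interQ u l) : IsSig u := by
  apply isSig_of_step
  intro i j hij
  have a := h.2 i j hij
  have b := h.1 j
  omega

lemma interQ_sig_right {p : ℕ} {u l : Fin p → ℤ} (h : interQ u l) : IsSig l := by
  apply isSig_of_step
  intro i j hij
  have a := h.2 i j hij
  have b := h.1 i
  omega

/-- Existence of a signature with given conjugate. -/
lemma exists_sig (p k : ℕ) (c0 : ℤ) (f : ℕ → ℕ) (hf0 : f 0 = p) (hfk : f k = 0)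
    (hf : ∀ j, j < k → f (j + 1) ≤ f j) :
    ∃ u : Fin p → ℤ, IsSig u ∧ (∀ i, c0 ≤ u i) ∧ (∀ i, u i < c0 + k) ∧
      ∀ j, j ≤ k → cj u (c0 + j) = f j := by
  have anti : ∀ d i, i + d ≤ k → f (i + d) ≤ f i := by
    intro d
    induction d with
    | zero => intro i _; simp
    | succ d ih =>
      intro i hi
      have a := ih i (by omega)
      have b := hf (i + d) (by omega)
      rw [← add_assoc]
      omega
  have anti' : ∀ i j, i ≤ j → j ≤ k → f j ≤ f i := by
    intro i j hij hj
    have := anti (j - i) i (by omega)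
    rwa [show i + (j - i) = j by omega] at this
  -- number of steps
  let N : ℕ → ℕ := fun i => ((Finset.range k).filter fun j => i < f (j + 1)).card
  have hN : ∀ i j, j < k → (j < N i ↔ i < f (j + 1)) := by
    intro i j hj
    constructor
    · intro h
      by_contra hc
      have hsub : ((Finset.range k).filter fun j => i < f (j + 1)) ⊆ Finset.range j := by
        intro a ha
        simp only [Finset.mem_filter, Finset.mem_range] at *
        by_contra hja
        have := anti' (j + 1) (a + 1) (by omega) (by omega)
        omega
      have := Finset.card_le_card hsub
      rw [Finset.card_range] at this
      change j < ((Finset.range k).filter fun j => i < f (j + 1)).card at h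
      omega
    · intro h
      have hsub : Finset.range (j + 1) ⊆ ((Finset.range k).filter fun j => i < f (j + 1)) := by
        intro a ha
        simp only [Finset.mem_filter, Finset.mem_range] at *
        have := anti' (a + 1) (j + 1) (by omega) (by omega)
        omega
      have := Finset.card_le_card hsub
      rw [Finset.card_range] at this
      change j < ((Finset.range k).filter fun j => i < f (j + 1)).card
      omega
  have hNk : ∀ i, N i ≤ k := by
    intro i
    exact (Finset.card_filter_le _ _).trans (by simp)
  refine ⟨fun i => c0 + N i, ?_, ?_, ?_, ?_⟩
  · intro i j hij
    have : N j ≤ N i := by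
      apply Finset.card_le_card
      intro a ha
      simp only [Finset.mem_filter] at *
      have : (i : ℕ) ≤ j := hij
      exact ⟨ha.1, by omega⟩
    simp only
    omega
  · intro i
    simp
  · intro i
    have hk : k ≠ 0 := by
      rintro rfl
      have := i.isLt
      omega
    have := hN i (k - 1) (by omega)
    rw [show k - 1 + 1 = k by omega, hfk] at this
    simp only
    have := hNk i
    omega
  · intro j hj
    rcases Nat.eq_zero_or_pos j with rfl | hj0
    · rw [hf0]
      apply cj_bot
      intro i
      simp
    · have e : (Finset.univ.filter fun i : Fin p => c0 + (j : ℤ) ≤ c0 + (N i : ℤ))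
          = Finset.univ.filter fun i : Fin p => (i : ℕ) < f j := by
        ext i
        simp only [Finset.mem_filter, Finset.mem_univ, true_and]
        have := hN i (j - 1) (by omega)
        rw [show j - 1 + 1 = j by omega] at this
        rw [← this]
        omega
      unfold cj
      rw [e, Fin.card_filter_val_lt]
      have := anti' 0 j (by omega) hj
      omega

lemma sig_ext {p : ℕ} {u v : Fin p → ℤ} (hu : IsSig u) (hv : IsSig v) (k : ℕ) (c0 : ℤ)
    (hu1 : ∀ i, c0 ≤ u i) (hu2 : ∀ i, u i < c0 + k) (hv1 : ∀ i, c0 ≤ v i) (hv2 : ∀ i, v i < c0 + k)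
    (h : ∀ j : ℕ, j ≤ k → cj u (c0 + j) = cj v (c0 + j)) : u = v := by
  funext i
  apply le_antisymm
  · rw [← lt_cj_iff hv i (u i)]
    have a := h (u i - c0).toNat (by have := hu1 i; have := hu2 i; omega)
    rw [show c0 + ((u i - c0).toNat : ℤ) = u i by have := hu1 i; omega] at a
    rw [← a, lt_cj_iff hu]
  · rw [← lt_cj_iff hu i (v i)]
    have a := h (v i - c0).toNat (by have := hv1 i; have := hv2 i; omega)
    rw [show c0 + ((v i - c0).toNat : ℤ) = v i by have := hv1 i; omega] at a
    rw [a, lt_cj_iff hv]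

/-- Common shape of the weights `ψ` and `φ`. -/
def gw {R : Type*} [CommRing R] (t : R) (A B : ℤ → ℕ) : R :=
  ∏ᶠ c : ℤ, if A c = B c + 1 then 1 - t ^ A c else 1

lemma gw_window {R : Type*} [CommRing R] (t : R) (A B : ℤ → ℕ) (c0 : ℤ) (k : ℕ)
    (hA : ∀ c, A c ≠ 0 → c0 ≤ c ∧ c < c0 + k) :
    gw t A B = ∏ j : Fin k, if A (c0 + (j : ℕ)) = B (c0 + (j : ℕ)) + 1
      then 1 - t ^ A (c0 + (j : ℕ)) else 1 := by
  unfold gw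
  rw [finprod_eq_prod_of_mulSupport_subset (s := Finset.univ.image (fun j : Fin k => c0 + ((j : ℕ) : ℤ)))]
  · rw [Finset.prod_image]
    intro a _ b _ h
    apply Fin.ext
    simp only at h
    omega
  · intro c hc
    rw [Function.mem_mulSupport] at hc
    have h1 : A c ≠ 0 := by
      intro h
      apply hc
      rw [if_neg]
      omega
    have h2 := hA c h1
    simp only [Finset.coe_image, Finset.coe_univ, Set.image_univ, Set.mem_range]
    exact ⟨⟨(c - c0).toNat, by omega⟩, by simp; omega⟩

/-- Local site weight. -/
def wt {R : Type*} [CommRing R] (z α β : R) (δ δ' : ℤ) (b b' : Bool) : R :=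
  if (b'.toNat : ℤ) = δ' ∨ (b'.toNat : ℤ) = δ' + 1 then
    z ^ b'.toNat * (if b.toNat = 1 ∧ b'.toNat = 0 then α else 1) *
      (if (b.toNat : ℤ) = δ ∧ (b'.toNat : ℤ) = δ' + 1 then β else 1)
  else 0

/-- Transfer vectors. -/
def tv {R : Type*} [CommRing R] (w : ℕ → Bool → Bool → R) : ℕ → Bool → R
  | 0, b => if b then 0 else 1
  | k + 1, b' => tv w k false * w k false b' + tv w k true * w k true b'

lemma tv_path {R : Type*} [CommRing R] (w : ℕ → Bool → Bool → R) (k : ℕ) (b' : Bool) :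
    tv w k b' = ∑ β : Fin (k + 1) → Bool,
      if β 0 = false ∧ β (Fin.last k) = b' then
        ∏ j : Fin k, w j (β j.castSucc) (β j.succ) else 0 := by
  induction k generalizing b' with
  | zero =>
    rw [← (Equiv.funUnique (Fin 1) Bool).symm.sum_comp]
    cases b' <;> simp [tv]
  | succ k ih =>
    have hsum : ∀ f : (Fin (k + 1 + 1) → Bool) → R,
        ∑ β, f β = ∑ b : Bool, ∑ β : Fin (k + 1) → Bool, f (Fin.snoc β b) := by
      intro f
      rw [← (Fin.snocEquiv (fun _ => Bool)).sum_comp, Fintype.sum_prod_type]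
      rfl
    rw [hsum]
    simp only [tv, ih]
    rw [Fintype.sum_eq_single b', Finset.sum_mul, Finset.sum_mul, ← Finset.sum_add_distrib]
    · apply Finset.sum_congr rfl
      intro β _
      have h0 : (Fin.snoc β b' : Fin (k + 1 + 1) → Bool) 0 = β 0 := by
        exact Fin.snoc_castSucc (α := fun _ => Bool) b' β 0
      have hl : (Fin.snoc β b' : Fin (k + 1 + 1) → Bool) (Fin.last (k + 1)) = b' := by simp
      simp only [h0, hl]
      rw [Fin.prod_univ_castSucc]
      have h3 : ∀ j : Fin k, (Fin.snoc β b' : Fin (k + 1 + 1) → Bool) j.castSucc.succ = β j.succ := by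
        intro j
        rw [Fin.succ_castSucc, Fin.snoc_castSucc (α := fun _ => Bool)]
      have h2 : ∀ j : Fin (k + 1), (Fin.snoc β b' : Fin (k + 1 + 1) → Bool) j.castSucc = β j := by
        intro j
        rw [Fin.snoc_castSucc (α := fun _ => Bool)]
      simp only [h2, h3, Fin.succ_last, hl, Fin.val_castSucc, Fin.val_last]
      cases hb : β (Fin.last k) <;> by_cases h : β 0 = false <;> simp [h]
    · intro b hb
      apply Finset.sum_eq_zero
      intro β _
      rw [if_neg]
      simp [hb]

/-- The intertwining invariant. -/
def HInv {R : Type*} [CommRing R] (z t : R) (δ : ℤ) (L0 L1 R0 R1 : R) : Prop :=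
  if δ = 0 then (z - t) * L0 = t * (z - 1) * R0 + (1 - t) * R1 ∧
      (z - t) * L1 = z * (1 - t) * R0 + (z - 1) * R1
  else (δ = 1 ∧ L0 = 0 ∧ R0 = 0 ∧ L1 = R1) ∨ (δ = -1 ∧ L1 = 0 ∧ R1 = 0 ∧ L0 = R0) ∨
    (L0 = 0 ∧ L1 = 0 ∧ R0 = 0 ∧ R1 = 0)

lemma inv_step {R : Type*} [CommRing R] [IsDomain R] (z t : R) (hz : z - t ≠ 0) (M N : ℕ)
    (δ δ' : ℤ) (hMN : (M : ℤ) - N = δ - δ') (L0 L1 R0 R1 : R) (h : HInv z t δ L0 L1 R0 R1) :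
    HInv z t δ'
      (L0 * wt z (1 - t ^ (N + 1)) (1 - t ^ M) δ δ' false false
        + L1 * wt z (1 - t ^ (N + 1)) (1 - t ^ M) δ δ' true false)
      (L0 * wt z (1 - t ^ (N + 1)) (1 - t ^ M) δ δ' false true
        + L1 * wt z (1 - t ^ (N + 1)) (1 - t ^ M) δ δ' true true)
      (R0 * wt z (1 - t ^ M) (1 - t ^ (N + 1)) δ δ' false false
        + R1 * wt z (1 - t ^ M) (1 - t ^ (N + 1)) δ δ' true false)
      (R0 * wt z (1 - t ^ M) (1 - t ^ (N + 1)) δ δ' false true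
        + R1 * wt z (1 - t ^ M) (1 - t ^ (N + 1)) δ δ' true true) := by
  by_cases hd : δ = 0
  · subst hd
    unfold HInv at h
    rw [if_pos rfl] at h
    obtain ⟨h0, h1⟩ := h
    by_cases hd' : δ' = 0
    · subst hd'
      have : M = N := by omega
      subst this
      unfold HInv
      rw [if_pos rfl]
      simp [wt]
      constructor
      · linear_combination h0 + (1 - t ^ (M + 1)) * h1
      · linear_combination (1 - t ^ M) * z * h0 + z * h1
    · by_cases h1' : δ' = 1
      · subst h1'
        unfold HInv
        rw [if_neg (by decide)]
        left
        simp [wt]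
        apply mul_left_cancel₀ hz
        linear_combination z * h0 + z * h1
      · by_cases h2' : δ' = -1
        · subst h2'
          have : M = N + 1 := by omega
          subst this
          unfold HInv
          rw [if_neg (by decide)]
          right; left
          simp [wt]
          apply mul_left_cancel₀ hz
          linear_combination (1 - t ^ (N + 1)) * h0 + (1 - t ^ (N + 1)) * h1
        · unfold HInv
          rw [if_neg hd']
          right; right
          have e0 : ¬ ((0 : ℤ) = δ' ∨ (0 : ℤ) = δ' + 1) := by omega
          have e1 : ¬ ((1 : ℤ) = δ' ∨ δ' = 0) := by omega
          simp [wt, e0, e1]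
  · unfold HInv at h
    rw [if_neg hd] at h
    rcases h with ⟨rfl, rfl, rfl, rfl⟩ | ⟨rfl, rfl, rfl, rfl⟩ | ⟨rfl, rfl, rfl, rfl⟩
    · by_cases hd' : δ' = 0
      · subst hd'
        have : M = N + 1 := by omega
        subst this
        unfold HInv
        rw [if_pos rfl]
        simp [wt]
        constructor <;> ring
      · by_cases h1' : δ' = 1
        · subst h1'
          unfold HInv
          rw [if_neg (by decide)]
          left
          simp [wt]
        · by_cases h2' : δ' = -1
          · subst h2'
            unfold HInv
            rw [if_neg (by decide)]
            right; left
            simp [wt]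
            left
            ring
          · unfold HInv
            rw [if_neg hd']
            right; right
            have e0 : ¬ ((0 : ℤ) = δ' ∨ (0 : ℤ) = δ' + 1) := by omega
            have e1 : ¬ ((1 : ℤ) = δ' ∨ δ' = 0) := by omega
            simp [wt, e0, e1]
    · by_cases hd' : δ' = 0
      · subst hd'
        unfold HInv
        rw [if_pos rfl]
        simp [wt]
        constructor <;> ring
      · by_cases h1' : δ' = 1
        · subst h1'
          unfold HInv
          rw [if_neg (by decide)]
          left
          simp [wt]
        · by_cases h2' : δ' = -1
          · subst h2'
            unfold HInv
            rw [if_neg (by decide)]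
            right; left
            simp [wt]
          · unfold HInv
            rw [if_neg hd']
            right; right
            have e0 : ¬ ((0 : ℤ) = δ' ∨ (0 : ℤ) = δ' + 1) := by omega
            have e1 : ¬ ((1 : ℤ) = δ' ∨ δ' = 0) := by omega
            simp [wt, e0, e1]
    · unfold HInv
      simp

/-- Final consequence of the invariant. -/
lemma transfer_main {R : Type*} [CommRing R] [IsDomain R] (z t : R) (hz : z - t ≠ 0)
    (F G M N : ℕ → ℕ) (hF : ∀ j, M j + F (j + 1) = F j) (hG : ∀ j, N j + G (j + 1) = G j)
    (h0 : F 0 + 1 = G 0) (k : ℕ) (hk : F k = G k) :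
    (1 - z) * tv (fun j => wt z (1 - t ^ (N j + 1)) (1 - t ^ M j) (F j - G j) (F (j + 1) - G (j + 1))) k false
    + (1 - t) * tv (fun j => wt z (1 - t ^ (N j + 1)) (1 - t ^ M j) (F j - G j) (F (j + 1) - G (j + 1))) k true
    = (1 - t * z) *
      tv (fun j => wt z (1 - t ^ M j) (1 - t ^ (N j + 1)) (F j - G j) (F (j + 1) - G (j + 1))) k false := by
  have key : ∀ k, HInv z t ((F k : ℤ) - G k)
      (tv (fun j => wt z (1 - t ^ (N j + 1)) (1 - t ^ M j) (F j - G j) (F (j + 1) - G (j + 1))) k false)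
      (tv (fun j => wt z (1 - t ^ (N j + 1)) (1 - t ^ M j) (F j - G j) (F (j + 1) - G (j + 1))) k true)
      (tv (fun j => wt z (1 - t ^ M j) (1 - t ^ (N j + 1)) (F j - G j) (F (j + 1) - G (j + 1))) k false)
      (tv (fun j => wt z (1 - t ^ M j) (1 - t ^ (N j + 1)) (F j - G j) (F (j + 1) - G (j + 1))) k true) := by
    intro k
    induction k with
    | zero =>
      have : (F 0 : ℤ) - G 0 = -1 := by omega
      rw [this]
      simp [HInv, tv]
    | succ k ih =>
      exact inv_step z t hz (M k) (N k) _ _ (by have := hF k; have := hG k; omega) _ _ _ _ ih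
  have := key k
  unfold HInv at this
  rw [if_pos (by omega)] at this
  obtain ⟨a, b⟩ := this
  apply mul_left_cancel₀ hz
  linear_combination (1 - z) * a + (1 - t) * b

lemma tv_true_grow {R : Type*} [CommRing R] (z t : R)
    (F G M N : ℕ → ℕ) (k0 : ℕ) (hF : ∀ j, k0 ≤ j → F j = 0) (hG : ∀ j, k0 ≤ j → G j = 0)
    (hM : ∀ j, k0 ≤ j → M j = 0) (r : ℕ) :
    tv (fun j => wt z (1 - t ^ (N j + 1)) (1 - t ^ M j) (F j - G j) (F (j + 1) - G (j + 1))) (k0 + r) true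
     = z ^ r * tv (fun j => wt z (1 - t ^ (N j + 1)) (1 - t ^ M j) (F j - G j) (F (j + 1) - G (j + 1))) k0 true := by
  induction r with
  | zero => simp
  | succ r ih =>
    rw [← add_assoc, tv, ih]
    rw [hF (k0 + r) (by omega), hG (k0 + r) (by omega), hM (k0 + r) (by omega),
      hF (k0 + r + 1) (by omega), hG (k0 + r + 1) (by omega)]
    simp [wt]
    ring

lemma mcount_window {p : ℕ} (l : Fin p → ℤ) (c0 : ℤ) (k : ℕ)
    (h1 : ∀ i, c0 ≤ l i) (h2 : ∀ i, l i < c0 + k) (c : ℤ) (hc : mcount l c ≠ 0) :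
    c0 ≤ c ∧ c < c0 + k := by
  by_contra hcon
  apply hc
  apply mcount_zero_of_lt
  intro i hi
  have := h1 i
  have := h2 i
  omega

lemma prod_pow_cj {R : Type*} [CommRing R] (z : R) {p q : ℕ} (u : Fin p → ℤ) (v : Fin q → ℤ) (c0 : ℤ)
    (k : ℕ) (hu1 : ∀ i, c0 ≤ u i) (hu2 : ∀ i, u i < c0 + k)
    (hv1 : ∀ i, c0 ≤ v i) (hv2 : ∀ i, v i < c0 + k) (hpq : p = q) (b : Fin k → ℕ)
    (hb : ∀ j : Fin k, cj u (c0 + ((j + 1 : ℕ) : ℤ)) = cj v (c0 + ((j + 1 : ℕ) : ℤ)) + b j) :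
    ∏ j : Fin k, z ^ b j = z ^ (sumz u - sumz v).toNat := by
  subst hpq
  rw [Finset.prod_pow_eq_pow_sum]
  congr 1
  rw [sumz_eq_cj u c0 k hu1 (fun i => (hu2 i).le), sumz_eq_cj v c0 k hv1 (fun i => (hv2 i).le)]
  have : ∑ j : Fin k, (cj u (c0 + ((j + 1 : ℕ) : ℤ)) : ℤ)
      = ∑ j : Fin k, (cj v (c0 + ((j + 1 : ℕ) : ℤ)) : ℤ) + ((∑ j, b j : ℕ) : ℤ) := by
    rw [Nat.cast_sum, ← Finset.sum_add_distrib]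
    apply Finset.sum_congr rfl
    intro j _
    rw [hb j]
    push_cast
    rfl
  rw [this]
  omega

section
variable {R : Type*} [CommRing R] (z t : R) {n : ℕ}

/-- Left weights for `μ, ν`. -/
def wL (μ : Fin n → ℤ) (ν : Fin (n + 1) → ℤ) (c0 : ℤ) : ℕ → Bool → Bool → R := fun j =>
  wt z (1 - t ^ (mcount ν (c0 + j) + 1)) (1 - t ^ mcount μ (c0 + j))
    (cj μ (c0 + j) - cj ν (c0 + j)) (cj μ (c0 + (j + 1 : ℕ)) - cj ν (c0 + (j + 1 : ℕ)))

/-- Right weights for `μ, ν`. -/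
def wR (μ : Fin n → ℤ) (ν : Fin (n + 1) → ℤ) (c0 : ℤ) : ℕ → Bool → Bool → R := fun j =>
  wt z (1 - t ^ mcount μ (c0 + j)) (1 - t ^ (mcount ν (c0 + j) + 1))
    (cj μ (c0 + j) - cj ν (c0 + j)) (cj μ (c0 + (j + 1 : ℕ)) - cj ν (c0 + (j + 1 : ℕ)))

/-- Finset of intermediate signatures above. -/
def SL (μ : Fin n → ℤ) (ν : Fin (n + 1) → ℤ) (c0 : ℤ) (k : ℕ) : Finset (Fin (n + 1) → ℤ) :=
  (Fintype.piFinset fun _ : Fin (n + 1) => Finset.Ico c0 (c0 + k)).filter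
    (fun l => interP μ l ∧ interQ ν l)

/-- Finset of intermediate signatures below. -/
def SR (μ : Fin n → ℤ) (ν : Fin (n + 1) → ℤ) (c0 : ℤ) (k : ℕ) : Finset (Fin n → ℤ) :=
  (Fintype.piFinset fun _ : Fin n => Finset.Ico c0 (c0 + k)).filter
    (fun l => interP l ν ∧ interQ l μ)

lemma mcount_step {p : ℕ} (l : Fin p → ℤ) (c0 : ℤ) (j : ℕ) :
    mcount l (c0 + j) + cj l (c0 + (j + 1 : ℕ)) = cj l (c0 + j) := by
  have := mcount_add_cj l (c0 + j)
  rw [add_assoc] at this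
  push_cast
  exact this

lemma sumL (μ : Fin n → ℤ) (ν : Fin (n + 1) → ℤ) (hμ : IsSig μ) (hν : IsSig ν) (c0 : ℤ) (k : ℕ)
    (hμ1 : ∀ i, c0 ≤ μ i) (hμ2 : ∀ i, μ i < c0 + k)
    (hν1 : ∀ i, c0 ≤ ν i) (hν2 : ∀ i, ν i < c0 + k) :
    tv (wL z t μ ν c0) k false = ∑ l ∈ SL μ ν c0 k,
      gw t (mcount l) (mcount ν) * gw t (mcount μ) (mcount l) * z ^ (sumz l - sumz ν).toNat := by
  rw [tv_path]
  symm
  apply Finset.sum_of_injOn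
    (fun (l : Fin (n + 1) → ℤ) => fun j : Fin (k + 1) =>
      decide (cj l (c0 + (j : ℕ)) ≠ cj ν (c0 + (j : ℕ))))
  · intro l hl l' hl' hll
    simp only [SL, Finset.coe_filter, Fintype.mem_piFinset, Finset.mem_Ico, Set.mem_ofPred_eq] at hl hl'
    have s1 := interQ_sig_right hl.2.2
    have s2 := interQ_sig_right hl'.2.2
    apply sig_ext s1 s2 k c0 (fun i => (hl.1 i).1) (fun i => (hl.1 i).2)
      (fun i => (hl'.1 i).1) (fun i => (hl'.1 i).2)
    intro j hj
    have h := congrFun hll ⟨j, by omega⟩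
    simp only [ne_eq, decide_not, Bool.not_eq_eq_eq_not, Bool.not_not, decide_eq_decide] at h
    have a := (interQ_iff hν s1).1 hl.2.2 (c0 + j)
    have b := (interQ_iff hν s2).1 hl'.2.2 (c0 + j)
    omega
  · intro l _
    simp
  · intro β _ hβ
    by_contra hne
    apply hβ
    rw [ite_eq_right_iff, Classical.not_imp] at hne
    obtain ⟨⟨hb0, hbk⟩, hprod⟩ := hne
    have hw : ∀ j : Fin k, wL z t μ ν c0 j (β j.castSucc) (β j.succ) ≠ 0 := by
      intro j hj
      exact hprod (Finset.prod_eq_zero (Finset.mem_univ j) hj)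
    -- path values
    let bb : ℕ → ℕ := fun j => if h : j < k + 1 then (β ⟨j, h⟩).toNat else 0
    have bb1 : ∀ j, bb j ≤ 1 := by
      intro j
      simp only [bb]
      split_ifs
      · exact Bool.toNat_le _
      · omega
    have bb0 : bb 0 = 0 := by
      simp only [bb]
      rw [dif_pos (by omega)]
      have : β ⟨0, by omega⟩ = false := hb0
      rw [this]; rfl
    have bbk : bb k = 0 := by
      simp only [bb]
      rw [dif_pos (by omega)]
      have : β ⟨k, by omega⟩ = false := hbk
      rw [this]; rfl
    have hcast : ∀ j : Fin k, (β j.castSucc).toNat = bb j := by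
      intro j
      simp only [bb]
      rw [dif_pos (by omega)]
      rfl
    have hsucc : ∀ j : Fin k, (β j.succ).toNat = bb (j + 1) := by
      intro j
      simp only [bb]
      rw [dif_pos (by omega)]
      rfl
    have hallow' : ∀ j, j < k → ((bb (j + 1) : ℤ) = cj μ (c0 + (j + 1 : ℕ)) - cj ν (c0 + (j + 1 : ℕ)) ∨
        (bb (j + 1) : ℤ) = cj μ (c0 + (j + 1 : ℕ)) - cj ν (c0 + (j + 1 : ℕ)) + 1) := by
      intro j hj
      have := hw ⟨j, hj⟩
      unfold wL wt at this
      rw [hsucc ⟨j, hj⟩] at this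
      by_contra hcon
      apply this
      rw [if_neg hcon]
    have hallow : ∀ j, j ≤ k → ((bb j : ℤ) = cj μ (c0 + j) - cj ν (c0 + j) ∨
        (bb j : ℤ) = cj μ (c0 + j) - cj ν (c0 + j) + 1) := by
      intro j hj
      rcases j with _ | j
      · rw [bb0]
        right
        rw [cj_bot μ _ (by simpa using hμ1), cj_bot ν _ (by simpa using hν1)]
        push_cast
        ring
      · exact hallow' j (by omega)
    have hanti : ∀ j, j < k → cj ν (c0 + (j + 1 : ℕ)) + bb (j + 1) ≤ cj ν (c0 + j) + bb j := by
      intro j hj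
      by_contra hcon
      have e1 := mcount_step ν c0 j
      have e2 := mcount_step μ c0 j
      have a1 := bb1 j
      have a2 := bb1 (j + 1)
      have b1 := hallow j (by omega)
      have b2 := hallow' j hj
      apply hw ⟨j, hj⟩
      unfold wL wt
      rw [hcast ⟨j, hj⟩, hsucc ⟨j, hj⟩]
      simp only
      have hM : mcount μ (c0 + j) = 0 := by omega
      rw [if_pos b2, hM, if_pos (c := ((bb j : ℤ) = _ ∧ _)) (by omega)]
      simp
    obtain ⟨u, hu, hu1, hu2, hu3⟩ := exists_sig (n + 1) k c0 (fun j => cj ν (c0 + j) + bb j)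
      (by rw [bb0, cj_bot ν _ (by simpa using hν1)])
      (by rw [bbk, cj_top ν _ hν2]) hanti
    have hrel : ∀ c, (cj ν c ≤ cj u c ∧ cj u c ≤ cj ν c + 1) ∧ (cj μ c ≤ cj u c ∧ cj u c ≤ cj μ c + 1) := by
      intro c
      by_cases hc1 : c < c0
      · rw [cj_bot μ c (fun i => by have := hμ1 i; omega), cj_bot ν c (fun i => by have := hν1 i; omega),
          cj_bot u c (fun i => by have := hu1 i; omega)]
        omega
      · by_cases hc2 : c0 + k < c
        · rw [cj_top μ c (fun i => by have := hμ2 i; omega), cj_top ν c (fun i => by have := hν2 i; omega),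
            cj_top u c (fun i => by have := hu2 i; omega)]
          omega
        · obtain ⟨j, rfl⟩ : ∃ j : ℕ, c = c0 + j := ⟨(c - c0).toNat, by omega⟩
          have hj : j ≤ k := by omega
          have a := hu3 j hj
          have b := hallow j hj
          have d := bb1 j
          omega
    refine ⟨u, ?_, ?_⟩
    · simp only [SL, Finset.coe_filter, Fintype.mem_piFinset, Finset.mem_Ico, Set.mem_ofPred_eq]
      exact ⟨fun i => ⟨hu1 i, hu2 i⟩, (interP_iff hμ hu).2 fun c => (hrel c).2,
        (interQ_iff hν hu).2 fun c => (hrel c).1⟩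
    · funext j
      have a := hu3 j (by omega)
      have e : bb j = (β j).toNat := by
        simp only [bb]
        rw [dif_pos (by omega)]
      rw [e] at a
      cases hb : β j
      · rw [hb] at a
        simp at a
        simp [a]
      · rw [hb] at a
        simp at a
        simp [a]
  · intro l hl
    simp only [SL, Finset.mem_filter, Fintype.mem_piFinset, Finset.mem_Ico] at hl
    obtain ⟨hwin, hP, hQ⟩ := hl
    have hl := interQ_sig_right hQ
    have hP' := (interP_iff hμ hl).1 hP
    have hQ' := (interQ_iff hν hl).1 hQ
    have hl1 := fun i => (hwin i).1
    have hl2 := fun i => (hwin i).2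
    have hbv : ∀ c, ((decide (cj l c ≠ cj ν c)).toNat : ℕ) + cj ν c = cj l c := by
      intro c
      have := hQ' c
      by_cases h : cj l c = cj ν c
      · simp [h]
      · simp [h]
        omega
    rw [if_pos]
    · simp only [Fin.val_castSucc, Fin.val_succ]
      rw [gw_window t (mcount l) (mcount ν) c0 k (mcount_window l c0 k hl1 hl2),
        gw_window t (mcount μ) (mcount l) c0 k (mcount_window μ c0 k hμ1 hμ2),
        ← prod_pow_cj z l ν c0 k hl1 hl2 hν1 hν2 rfl
          (fun j => (decide (cj l (c0 + ((j + 1 : ℕ) : ℤ)) ≠ cj ν (c0 + ((j + 1 : ℕ) : ℤ)))).toNat)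
          (fun j => (hbv _).symm.trans (add_comm _ _)),
        ← Finset.prod_mul_distrib, ← Finset.prod_mul_distrib]
      apply Finset.prod_congr rfl
      intro j _
      unfold wL wt
      have v1 := hbv (c0 + (j : ℕ))
      have v2 := hbv (c0 + ((j + 1 : ℕ) : ℤ))
      have p1 := hP' (c0 + (j : ℕ))
      have p2 := hP' (c0 + ((j + 1 : ℕ) : ℤ))
      have q1 := hQ' (c0 + (j : ℕ))
      have q2 := hQ' (c0 + ((j + 1 : ℕ) : ℤ))
      have e1 := mcount_step ν c0 j
      have e2 := mcount_step μ c0 j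
      have e3 := mcount_step l c0 j
      generalize hB : (decide (cj l (c0 + (j : ℕ)) ≠ cj ν (c0 + (j : ℕ)))) = B at *
      generalize hB' : (decide (cj l (c0 + ((j + 1 : ℕ) : ℤ)) ≠ cj ν (c0 + ((j + 1 : ℕ) : ℤ)))) = B' at *
      have r1 : B.toNat ≤ 1 := Bool.toNat_le _
      have r2 : B'.toNat ≤ 1 := Bool.toNat_le _
      have hall : (B'.toNat : ℤ) = cj μ (c0 + ((j + 1 : ℕ) : ℤ)) - cj ν (c0 + ((j + 1 : ℕ) : ℤ)) ∨
          (B'.toNat : ℤ) = cj μ (c0 + ((j + 1 : ℕ) : ℤ)) - cj ν (c0 + ((j + 1 : ℕ) : ℤ)) + 1 := by omega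
      have s1 : (if mcount l (c0 + (j : ℕ)) = mcount ν (c0 + (j : ℕ)) + 1 then
          1 - t ^ mcount l (c0 + (j : ℕ)) else 1) =
          (if B.toNat = 1 ∧ B'.toNat = 0 then 1 - t ^ (mcount ν (c0 + (j : ℕ)) + 1) else 1) := by
        by_cases h : mcount l (c0 + (j : ℕ)) = mcount ν (c0 + (j : ℕ)) + 1
        · rw [if_pos h, if_pos (by omega), h]
        · rw [if_neg h, if_neg (by omega)]
      have s2 : (if mcount μ (c0 + (j : ℕ)) = mcount l (c0 + (j : ℕ)) + 1 then
          1 - t ^ mcount μ (c0 + (j : ℕ)) else 1) =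
          (if (B.toNat : ℤ) = cj μ (c0 + (j : ℕ)) - cj ν (c0 + (j : ℕ)) ∧
            (B'.toNat : ℤ) = cj μ (c0 + ((j + 1 : ℕ) : ℤ)) - cj ν (c0 + ((j + 1 : ℕ) : ℤ)) + 1
            then 1 - t ^ mcount μ (c0 + (j : ℕ)) else 1) := by
        by_cases h : mcount μ (c0 + (j : ℕ)) = mcount l (c0 + (j : ℕ)) + 1
        · rw [if_pos h, if_pos (by omega)]
        · rw [if_neg h, if_neg (by omega)]
      rw [s1, s2, if_pos hall]
      ring
    · simp only [Fin.val_zero, Fin.val_last]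
      constructor
      · have h1 : cj l (c0 + ((0 : ℕ) : ℤ)) = cj ν (c0 + ((0 : ℕ) : ℤ)) := by
          rw [cj_bot l _ (by simpa using hl1), cj_bot ν _ (by simpa using hν1)]
        exact decide_eq_false (fun h => h h1)
      · have h1 : cj l (c0 + (k : ℤ)) = cj ν (c0 + (k : ℤ)) := by
          rw [cj_top l _ hl2, cj_top ν _ hν2]
        exact decide_eq_false (fun h => h h1)

lemma sumR (μ : Fin n → ℤ) (ν : Fin (n + 1) → ℤ) (hμ : IsSig μ) (hν : IsSig ν) (c0 : ℤ) (k : ℕ)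
    (hμ1 : ∀ i, c0 ≤ μ i) (hμ2 : ∀ i, μ i < c0 + k)
    (hν1 : ∀ i, c0 ≤ ν i) (hν2 : ∀ i, ν i < c0 + k) :
    tv (wR z t μ ν c0) k false = ∑ l ∈ SR μ ν c0 k,
      gw t (mcount μ) (mcount l) * gw t (mcount l) (mcount ν) * z ^ (sumz μ - sumz l).toNat := by
  rw [tv_path]
  symm
  apply Finset.sum_of_injOn
    (fun (l : Fin n → ℤ) => fun j : Fin (k + 1) =>
      decide (cj l (c0 + (j : ℕ)) ≠ cj μ (c0 + (j : ℕ))))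
  · intro l hl l' hl' hll
    simp only [SR, Finset.coe_filter, Fintype.mem_piFinset, Finset.mem_Ico, Set.mem_ofPred_eq] at hl hl'
    have s1 := interQ_sig_left hl.2.2
    have s2 := interQ_sig_left hl'.2.2
    apply sig_ext s1 s2 k c0 (fun i => (hl.1 i).1) (fun i => (hl.1 i).2)
      (fun i => (hl'.1 i).1) (fun i => (hl'.1 i).2)
    intro j hj
    have h := congrFun hll ⟨j, by omega⟩
    simp only [ne_eq, decide_not, Bool.not_eq_eq_eq_not, Bool.not_not, decide_eq_decide] at h
    have a := (interQ_iff s1 hμ).1 hl.2.2 (c0 + j)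
    have b := (interQ_iff s2 hμ).1 hl'.2.2 (c0 + j)
    omega
  · intro l _
    simp
  · intro β _ hβ
    by_contra hne
    apply hβ
    rw [ite_eq_right_iff, Classical.not_imp] at hne
    obtain ⟨⟨hb0, hbk⟩, hprod⟩ := hne
    have hw : ∀ j : Fin k, wR z t μ ν c0 j (β j.castSucc) (β j.succ) ≠ 0 := by
      intro j hj
      exact hprod (Finset.prod_eq_zero (Finset.mem_univ j) hj)
    -- path values
    let bb : ℕ → ℕ := fun j => if h : j < k + 1 then (β ⟨j, h⟩).toNat else 0
    have bb1 : ∀ j, bb j ≤ 1 := by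
      intro j
      simp only [bb]
      split_ifs
      · exact Bool.toNat_le _
      · omega
    have bb0 : bb 0 = 0 := by
      simp only [bb]
      rw [dif_pos (by omega)]
      have : β ⟨0, by omega⟩ = false := hb0
      rw [this]; rfl
    have bbk : bb k = 0 := by
      simp only [bb]
      rw [dif_pos (by omega)]
      have : β ⟨k, by omega⟩ = false := hbk
      rw [this]; rfl
    have hcast : ∀ j : Fin k, (β j.castSucc).toNat = bb j := by
      intro j
      simp only [bb]
      rw [dif_pos (by omega)]
      rfl
    have hsucc : ∀ j : Fin k, (β j.succ).toNat = bb (j + 1) := by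
      intro j
      simp only [bb]
      rw [dif_pos (by omega)]
      rfl
    have hallow' : ∀ j, j < k → ((bb (j + 1) : ℤ) = cj μ (c0 + (j + 1 : ℕ)) - cj ν (c0 + (j + 1 : ℕ)) ∨
        (bb (j + 1) : ℤ) = cj μ (c0 + (j + 1 : ℕ)) - cj ν (c0 + (j + 1 : ℕ)) + 1) := by
      intro j hj
      have := hw ⟨j, hj⟩
      unfold wR wt at this
      rw [hsucc ⟨j, hj⟩] at this
      by_contra hcon
      apply this
      rw [if_neg hcon]
    have hallow : ∀ j, j ≤ k → ((bb j : ℤ) = cj μ (c0 + j) - cj ν (c0 + j) ∨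
        (bb j : ℤ) = cj μ (c0 + j) - cj ν (c0 + j) + 1) := by
      intro j hj
      rcases j with _ | j
      · rw [bb0]
        right
        rw [cj_bot μ _ (by simpa using hμ1), cj_bot ν _ (by simpa using hν1)]
        push_cast
        ring
      · exact hallow' j (by omega)
    have hanti : ∀ j, j < k → (cj μ (c0 + (j + 1 : ℕ)) : ℤ) - bb (j + 1) ≤ cj μ (c0 + j) - bb j := by
      intro j hj
      by_contra hcon
      have e2 := mcount_step μ c0 j
      have a1 := bb1 j
      have a2 := bb1 (j + 1)
      have b2 := hallow' j hj
      apply hw ⟨j, hj⟩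
      unfold wR wt
      rw [hcast ⟨j, hj⟩, hsucc ⟨j, hj⟩]
      simp only
      have hM : mcount μ (c0 + j) = 0 := by omega
      rw [if_pos b2, hM, if_pos (c := (bb j = _ ∧ _)) (by omega)]
      simp
    have hnn : ∀ d j, j + d = k → (0 : ℤ) ≤ cj μ (c0 + j) - bb j := by
      intro d
      induction d with
      | zero =>
        intro j hj
        have : j = k := by omega
        rw [this, bbk]
        simp
      | succ d ih =>
        intro j hj
        have a := ih (j + 1) (by omega)
        have b := hanti j (by omega)
        omega
    have hle : ∀ j, j ≤ k → bb j ≤ cj μ (c0 + j) := by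
      intro j hj
      have := hnn (k - j) j (by omega)
      omega
    obtain ⟨u, hu, hu1, hu2, hu3⟩ := exists_sig n k c0 (fun j => cj μ (c0 + j) - bb j)
      (by rw [bb0, cj_bot μ _ (by simpa using hμ1)]; simp)
      (by rw [bbk, cj_top μ _ hμ2])
      (by
        intro j hj
        have a := hle j (by omega)
        have b := hle (j + 1) (by omega)
        have c := hanti j hj
        omega)
    have hrel : ∀ c, (cj u c ≤ cj ν c ∧ cj ν c ≤ cj u c + 1) ∧ (cj u c ≤ cj μ c ∧ cj μ c ≤ cj u c + 1) := by
      intro c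
      by_cases hc1 : c < c0
      · rw [cj_bot μ c (fun i => by have := hμ1 i; omega), cj_bot ν c (fun i => by have := hν1 i; omega),
          cj_bot u c (fun i => by have := hu1 i; omega)]
        omega
      · by_cases hc2 : c0 + k < c
        · rw [cj_top μ c (fun i => by have := hμ2 i; omega), cj_top ν c (fun i => by have := hν2 i; omega),
            cj_top u c (fun i => by have := hu2 i; omega)]
          omega
        · obtain ⟨j, rfl⟩ : ∃ j : ℕ, c = c0 + j := ⟨(c - c0).toNat, by omega⟩
          have hj : j ≤ k := by omega
          have a := hu3 j hj
          have b := hallow j hj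
          have d := bb1 j
          have e := hle j hj
          omega
    refine ⟨u, ?_, ?_⟩
    · simp only [SR, Finset.coe_filter, Fintype.mem_piFinset, Finset.mem_Ico, Set.mem_ofPred_eq]
      exact ⟨fun i => ⟨hu1 i, hu2 i⟩, (interP_iff hu hν).2 fun c => (hrel c).1,
        (interQ_iff hu hμ).2 fun c => (hrel c).2⟩
    · funext j
      have a := hu3 j (by omega)
      have e : bb j = (β j).toNat := by
        simp only [bb]
        rw [dif_pos (by omega)]
      have hh := hle j (by omega)
      rw [e] at a hh
      cases hb : β j
      · rw [hb] at a
        simp at a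
        simp [a]
      · rw [hb] at a hh
        simp at a hh
        simp [a]
        omega
  · intro l hl
    simp only [SR, Finset.mem_filter, Fintype.mem_piFinset, Finset.mem_Ico] at hl
    obtain ⟨hwin, hP, hQ⟩ := hl
    have hl := interQ_sig_left hQ
    have hP' := (interP_iff hl hν).1 hP
    have hQ' := (interQ_iff hl hμ).1 hQ
    have hl1 := fun i => (hwin i).1
    have hl2 := fun i => (hwin i).2
    have hbv : ∀ c, ((decide (cj l c ≠ cj μ c)).toNat : ℕ) + cj l c = cj μ c := by
      intro c
      have := hQ' c
      by_cases h : cj l c = cj μ c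
      · simp [h]
      · simp [h]
        omega
    rw [if_pos]
    · simp only [Fin.val_castSucc, Fin.val_succ]
      rw [gw_window t (mcount μ) (mcount l) c0 k (mcount_window μ c0 k hμ1 hμ2),
        gw_window t (mcount l) (mcount ν) c0 k (mcount_window l c0 k hl1 hl2),
        ← prod_pow_cj z μ l c0 k hμ1 hμ2 hl1 hl2 rfl
          (fun j => (decide (cj l (c0 + ((j + 1 : ℕ) : ℤ)) ≠ cj μ (c0 + ((j + 1 : ℕ) : ℤ)))).toNat)
          (fun j => (hbv _).symm.trans (add_comm _ _)),
        ← Finset.prod_mul_distrib, ← Finset.prod_mul_distrib]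
      apply Finset.prod_congr rfl
      intro j _
      unfold wR wt
      have v1 := hbv (c0 + (j : ℕ))
      have v2 := hbv (c0 + ((j + 1 : ℕ) : ℤ))
      have p1 := hP' (c0 + (j : ℕ))
      have p2 := hP' (c0 + ((j + 1 : ℕ) : ℤ))
      have q1 := hQ' (c0 + (j : ℕ))
      have q2 := hQ' (c0 + ((j + 1 : ℕ) : ℤ))
      have e1 := mcount_step ν c0 j
      have e2 := mcount_step μ c0 j
      have e3 := mcount_step l c0 j
      generalize hB : (decide (cj l (c0 + (j : ℕ)) ≠ cj μ (c0 + (j : ℕ)))) = B at *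
      generalize hB' : (decide (cj l (c0 + ((j + 1 : ℕ) : ℤ)) ≠ cj μ (c0 + ((j + 1 : ℕ) : ℤ)))) = B' at *
      have r1 : B.toNat ≤ 1 := Bool.toNat_le _
      have r2 : B'.toNat ≤ 1 := Bool.toNat_le _
      have hall : (B'.toNat : ℤ) = cj μ (c0 + ((j + 1 : ℕ) : ℤ)) - cj ν (c0 + ((j + 1 : ℕ) : ℤ)) ∨
          (B'.toNat : ℤ) = cj μ (c0 + ((j + 1 : ℕ) : ℤ)) - cj ν (c0 + ((j + 1 : ℕ) : ℤ)) + 1 := by omega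
      have s1 : (if mcount μ (c0 + (j : ℕ)) = mcount l (c0 + (j : ℕ)) + 1 then
          1 - t ^ mcount μ (c0 + (j : ℕ)) else 1) =
          (if B.toNat = 1 ∧ B'.toNat = 0 then 1 - t ^ mcount μ (c0 + (j : ℕ)) else 1) := by
        by_cases h : mcount μ (c0 + (j : ℕ)) = mcount l (c0 + (j : ℕ)) + 1
        · rw [if_pos h, if_pos (by omega)]
        · rw [if_neg h, if_neg (by omega)]
      have s2 : (if mcount l (c0 + (j : ℕ)) = mcount ν (c0 + (j : ℕ)) + 1 then
          1 - t ^ mcount l (c0 + (j : ℕ)) else 1) =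
          (if (B.toNat : ℤ) = cj μ (c0 + (j : ℕ)) - cj ν (c0 + (j : ℕ)) ∧
            (B'.toNat : ℤ) = cj μ (c0 + ((j + 1 : ℕ) : ℤ)) - cj ν (c0 + ((j + 1 : ℕ) : ℤ)) + 1
            then 1 - t ^ (mcount ν (c0 + (j : ℕ)) + 1) else 1) := by
        by_cases h : mcount l (c0 + (j : ℕ)) = mcount ν (c0 + (j : ℕ)) + 1
        · rw [if_pos h, if_pos (by omega), h]
        · rw [if_neg h, if_neg (by omega)]
      rw [s1, s2, if_pos hall]
      ring
    · simp only [Fin.val_zero, Fin.val_last]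
      constructor
      · have h1 : cj l (c0 + ((0 : ℕ) : ℤ)) = cj μ (c0 + ((0 : ℕ) : ℤ)) := by
          rw [cj_bot l _ (by simpa using hl1), cj_bot μ _ (by simpa using hμ1)]
        exact decide_eq_false (fun h => h h1)
      · have h1 : cj l (c0 + (k : ℤ)) = cj μ (c0 + (k : ℤ)) := by
          rw [cj_top l _ hl2, cj_top μ _ hμ2]
        exact decide_eq_false (fun h => h h1)

end

lemma exists_window {p q : ℕ} (u : Fin p → ℤ) (v : Fin q → ℤ) : ∃ (c0 : ℤ) (k : ℕ),
    (∀ i, c0 ≤ u i) ∧ (∀ i, u i < c0 + k) ∧ (∀ i, c0 ≤ v i) ∧ (∀ i, v i < c0 + k) := by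
  have a1 : ∀ i, |u i| ≤ ∑ i, |u i| := fun i =>
    Finset.single_le_sum (f := fun i => |u i|) (fun i _ => abs_nonneg _) (Finset.mem_univ i)
  have a2 : ∀ i, |v i| ≤ ∑ i, |v i| := fun i =>
    Finset.single_le_sum (f := fun i => |v i|) (fun i _ => abs_nonneg _) (Finset.mem_univ i)
  have b1 : 0 ≤ ∑ i, |u i| := Finset.sum_nonneg fun i _ => abs_nonneg _
  have b2 : 0 ≤ ∑ i, |v i| := Finset.sum_nonneg fun i _ => abs_nonneg _
  generalize ∑ i, |u i| = A at *
  generalize ∑ i, |v i| = B at *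
  refine ⟨-(A + B), (2 * (A + B) + 1).toNat, ?_, ?_, ?_, ?_⟩ <;> intro i
  · have := abs_le.1 (a1 i); omega
  · have := abs_le.1 (a1 i); omega
  · have := abs_le.1 (a2 i); omega
  · have := abs_le.1 (a2 i); omega

lemma gw_map {R S : Type*} [CommRing R] [CommRing S] (f : R →+* S) (t : R) {p : ℕ} (l : Fin p → ℤ)
    (B : ℤ → ℕ) : f (gw t (mcount l) B) = gw (f t) (mcount l) B := by
  obtain ⟨c0, k, h1, h2, -, -⟩ := exists_window l l
  rw [gw_window t (mcount l) B c0 k (mcount_window l c0 k h1 h2),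
    gw_window (f t) (mcount l) B c0 k (mcount_window l c0 k h1 h2), map_prod]
  apply Finset.prod_congr rfl
  intro j _
  split_ifs <;> simp

/-- Signatures above `ν` by a horizontal strip of size `r`. -/
def UQ {p : ℕ} (ν : Fin p → ℤ) (r : ℕ) : Finset (Fin p → ℤ) :=
  (Fintype.piFinset fun i : Fin p => Finset.Icc (ν i) (ν i + r)).filter
    (fun l => interQ ν l ∧ sumz l = sumz ν + r)

lemma le_of_sumz {p : ℕ} {ν l : Fin p → ℤ} (r : ℤ) (h : ∀ i, ν i ≤ l i)
    (hs : sumz l ≤ sumz ν + r) (i : Fin p) : l i ≤ ν i + r := by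
  have : l i - ν i ≤ ∑ i, (l i - ν i) :=
    Finset.single_le_sum (f := fun i => l i - ν i) (fun i _ => sub_nonneg.2 (h i)) (Finset.mem_univ i)
  rw [Finset.sum_sub_distrib] at this
  unfold sumz at hs
  omega

lemma sumz_mono {p : ℕ} {ν l : Fin p → ℤ} (h : ∀ i, ν i ≤ l i) : sumz ν ≤ sumz l :=
  Finset.sum_le_sum fun i _ => h i

lemma mem_UQ {p : ℕ} {ν l : Fin p → ℤ} {r : ℕ} :
    l ∈ UQ ν r ↔ interQ ν l ∧ sumz l = sumz ν + r := by
  unfold UQ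
  rw [Finset.mem_filter, Fintype.mem_piFinset, and_iff_right_iff_imp]
  intro h i
  rw [Finset.mem_Icc]
  exact ⟨h.1.1 i, le_of_sumz _ h.1.1 h.2.le i⟩

/-- Signatures below `l` in the branching order. -/
def DP {p : ℕ} (l : Fin (p + 1) → ℤ) : Finset (Fin p → ℤ) :=
  Fintype.piFinset fun i : Fin p => Finset.Icc (l i.succ) (l i.castSucc)

lemma mem_DP {p : ℕ} {l : Fin (p + 1) → ℤ} {μ : Fin p → ℤ} : μ ∈ DP l ↔ interP μ l := by
  unfold DP interP
  rw [Fintype.mem_piFinset]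
  simp only [Finset.mem_Icc]
  exact forall_congr' fun i => and_comm

/-- Left coefficient. -/
def Lc {R : Type*} [CommRing R] (t : R) {n : ℕ} (μ : Fin n → ℤ) (ν : Fin (n + 1) → ℤ) (r : ℕ) : R :=
  ∑ l ∈ UQ ν r, if interP μ l then gw t (mcount l) (mcount ν) * gw t (mcount μ) (mcount l) else 0

/-- Right coefficient. -/
def Rc {R : Type*} [CommRing R] (t : R) {n : ℕ} (μ : Fin n → ℤ) (ν : Fin (n + 1) → ℤ) (r : ℕ) : R :=
  ∑ κ ∈ DP ν, if μ ∈ UQ κ r then gw t (mcount μ) (mcount κ) * gw t (mcount κ) (mcount ν) else 0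

lemma coeff_sumL {R : Type*} [CommRing R] (t : R) {n : ℕ} (μ : Fin n → ℤ) (ν : Fin (n + 1) → ℤ)
    (hμ : IsSig μ) (hν : IsSig ν) (c0 : ℤ) (k0 k : ℕ)
    (hμ1 : ∀ i, c0 ≤ μ i) (hμ2 : ∀ i, μ i < c0 + k0)
    (hν1 : ∀ i, c0 ≤ ν i) (hν2 : ∀ i, ν i < c0 + k0) (r : ℕ) (hk : k0 + r ≤ k) :
    (tv (wL (Polynomial.X) (Polynomial.C t) μ ν c0) k false).coeff r = Lc t μ ν r := by
  rw [sumL _ _ μ ν hμ hν c0 k hμ1 (fun i => by have := hμ2 i; omega) hν1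
    (fun i => by have := hν2 i; omega), Polynomial.finsetSum_coeff, Lc, ← Finset.sum_filter]
  have hs : (SL μ ν c0 k).filter (fun l => r = (sumz l - sumz ν).toNat) = (UQ ν r).filter (interP μ) := by
    ext l
    simp only [SL, Finset.mem_filter, Fintype.mem_piFinset, Finset.mem_Ico, mem_UQ]
    constructor
    · rintro ⟨⟨-, h1, h2⟩, h3⟩
      have := sumz_mono h2.1
      exact ⟨⟨h2, by omega⟩, h1⟩
    · rintro ⟨⟨h2, h3⟩, h1⟩
      refine ⟨⟨fun i => ?_, h1, h2⟩, by omega⟩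
      have a := h2.1 i
      have b := le_of_sumz _ h2.1 h3.le i
      have := hν1 i
      have := hν2 i
      omega
  rw [← hs, Finset.sum_filter]
  apply Finset.sum_congr rfl
  intro l _
  rw [← gw_map Polynomial.C, ← gw_map Polynomial.C, ← Polynomial.C_mul, Polynomial.coeff_C_mul,
    Polynomial.coeff_X_pow]
  split_ifs <;> simp

lemma coeff_sumR {R : Type*} [CommRing R] (t : R) {n : ℕ} (μ : Fin n → ℤ) (ν : Fin (n + 1) → ℤ)
    (hμ : IsSig μ) (hν : IsSig ν) (c0 : ℤ) (k : ℕ)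
    (hμ1 : ∀ i, c0 ≤ μ i) (hμ2 : ∀ i, μ i < c0 + k)
    (hν1 : ∀ i, c0 ≤ ν i) (hν2 : ∀ i, ν i < c0 + k) (r : ℕ) :
    (tv (wR (Polynomial.X) (Polynomial.C t) μ ν c0) k false).coeff r = Rc t μ ν r := by
  rw [sumR _ _ μ ν hμ hν c0 k hμ1 hμ2 hν1 hν2, Polynomial.finsetSum_coeff, Rc, ← Finset.sum_filter]
  have hs : (SR μ ν c0 k).filter (fun l => r = (sumz μ - sumz l).toNat)
      = (DP ν).filter (fun κ => μ ∈ UQ κ r) := by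
    ext l
    simp only [SR, Finset.mem_filter, Fintype.mem_piFinset, Finset.mem_Ico, mem_UQ, mem_DP]
    constructor
    · rintro ⟨⟨-, h1, h2⟩, h3⟩
      have := sumz_mono h2.1
      exact ⟨h1, h2, by omega⟩
    · rintro ⟨h1, h2, h3⟩
      refine ⟨⟨fun i => ?_, h1, h2⟩, by omega⟩
      have a := h1 i
      have := hν1 i.succ
      have := hν2 i.castSucc
      omega
  rw [← hs, Finset.sum_filter]
  apply Finset.sum_congr rfl
  intro l _
  rw [← gw_map Polynomial.C, ← gw_map Polynomial.C, ← Polynomial.C_mul, Polynomial.coeff_C_mul,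
    Polynomial.coeff_X_pow]
  split_ifs <;> simp

lemma local_poly {R : Type*} [CommRing R] [IsDomain R] (t : R) {n : ℕ} (μ : Fin n → ℤ) (ν : Fin (n + 1) → ℤ)
    (c0 : ℤ) (k0 r : ℕ)
    (hμ1 : ∀ i, c0 ≤ μ i) (hμ2 : ∀ i, μ i < c0 + k0)
    (hν1 : ∀ i, c0 ≤ ν i) (hν2 : ∀ i, ν i < c0 + k0) :
    ∃ T : Polynomial R, (1 - Polynomial.X) * tv (wL (Polynomial.X) (Polynomial.C t) μ ν c0) (k0 + r) false
      + Polynomial.X ^ r * T =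
      (1 - Polynomial.C t * Polynomial.X) * tv (wR (Polynomial.X) (Polynomial.C t) μ ν c0) (k0 + r) false := by
  have hz : (Polynomial.X : Polynomial R) - Polynomial.C t ≠ 0 := Polynomial.X_sub_C_ne_zero t
  have hF0 : ∀ j, k0 ≤ j → cj μ (c0 + j) = 0 := fun j hj =>
    cj_top μ _ fun i => by have := hμ2 i; omega
  have hG0 : ∀ j, k0 ≤ j → cj ν (c0 + j) = 0 := fun j hj =>
    cj_top ν _ fun i => by have := hν2 i; omega
  have hM0 : ∀ j : ℕ, k0 ≤ j → mcount μ (c0 + j) = 0 := fun j hj =>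
    mcount_zero_of_lt μ _ fun i => by have := hμ2 i; omega
  have h := transfer_main (Polynomial.X : Polynomial R) (Polynomial.C t) hz
    (fun j => cj μ (c0 + j)) (fun j => cj ν (c0 + j))
    (fun j => mcount μ (c0 + j)) (fun j => mcount ν (c0 + j))
    (fun j => mcount_step μ c0 j) (fun j => mcount_step ν c0 j)
    (by
      rw [cj_bot μ _ (by simpa using hμ1), cj_bot ν _ (by simpa using hν1)]) (k0 + r)
    (by rw [hF0 _ (by omega), hG0 _ (by omega)])
  have h2 := tv_true_grow (Polynomial.X : Polynomial R) (Polynomial.C t)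
    (fun j => cj μ (c0 + j)) (fun j => cj ν (c0 + j))
    (fun j => mcount μ (c0 + j)) (fun j => mcount ν (c0 + j)) k0 hF0 hG0 hM0 r
  rw [h2] at h
  refine ⟨(1 - Polynomial.C t) * tv (wL (Polynomial.X) (Polynomial.C t) μ ν c0) k0 true, ?_⟩
  refine Eq.trans ?_ h
  unfold wL
  ring

lemma local_ident {R : Type*} [CommRing R] [IsDomain R] (t : R) {n : ℕ} (μ : Fin n → ℤ) (ν : Fin (n + 1) → ℤ)
    (hν : IsSig ν) :
    Lc t μ ν 0 = Rc t μ ν 0 ∧ ∀ r, Lc t μ ν (r + 1) - Lc t μ ν r = Rc t μ ν (r + 1) - t * Rc t μ ν r := by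
  by_cases hμ : IsSig μ
  · obtain ⟨c0, k0, hμ1, hμ2, hν1, hν2⟩ := exists_window μ ν
    have main : ∀ r, ∃ A B T : Polynomial R, (1 - Polynomial.X) * A + Polynomial.X ^ (r + 2) * T =
        (1 - Polynomial.C t * Polynomial.X) * B ∧ (∀ s, s ≤ r + 1 → A.coeff s = Lc t μ ν s) ∧
          (∀ s, B.coeff s = Rc t μ ν s) := by
      intro r
      obtain ⟨T, hT⟩ := local_poly t μ ν c0 k0 (r + 2) hμ1 hμ2 hν1 hν2
      refine ⟨_, _, T, hT, ?_, ?_⟩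
      · intro s hs
        exact coeff_sumL t μ ν hμ hν c0 k0 _ hμ1 hμ2 hν1 hν2 s (by omega)
      · intro s
        exact coeff_sumR t μ ν hμ hν c0 _ hμ1 (fun i => by have := hμ2 i; push_cast; omega) hν1
          (fun i => by have := hν2 i; push_cast; omega) s
    constructor
    · obtain ⟨A, B, T, h, hA, hB⟩ := main 0
      have := congrArg (fun p => Polynomial.coeff p 0) h
      simpa [← hA, ← hB] using this
    · intro r
      obtain ⟨A, B, T, h, hA, hB⟩ := main r
      have := congrArg (fun p => Polynomial.coeff p (r + 1)) h
      simp only [sub_mul, one_mul, mul_assoc, Polynomial.coeff_add, Polynomial.coeff_sub,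
        Polynomial.coeff_X_mul, Polynomial.coeff_C_mul] at this
      rw [Polynomial.coeff_X_pow_mul', if_neg (by omega), add_zero, hA _ (by omega), hA _ (by omega),
        hB, hB] at this
      exact this
  · have h1 : ∀ r, Lc t μ ν r = 0 := fun r => Finset.sum_eq_zero fun l _ =>
      if_neg fun h => hμ (interP_sig h)
    have h2 : ∀ r, Rc t μ ν r = 0 := fun r => Finset.sum_eq_zero fun l _ =>
      if_neg fun h => hμ (interQ_sig_right (mem_UQ.1 h).1)
    simp [h1, h2]

/-- Hall-Littlewood polynomials with a convenient recursion. -/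
def PP {K : Type*} [Field K] (t : K) : (n : ℕ) → (Fin n → ℤ) → (Fin n → K) → K
  | 0, _, _ => 1
  | n + 1, l, x => ∑ ν ∈ DP l, gw t (mcount ν) (mcount l) * x (Fin.last n) ^ (sumz l - sumz ν)
      * PP t n ν (fun i => x i.castSucc)

/-- Reindexing along an equality of lengths. -/
def castE {p q : ℕ} (h : p = q) : (Fin p → ℤ) ≃ (Fin q → ℤ) := (finCongr h).arrowCongr (Equiv.refl ℤ)

lemma castE_apply {p q : ℕ} (h : p = q) (l : Fin p → ℤ) (i : Fin q) :
    castE h l i = l (Fin.cast h.symm i) := rfl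

lemma mcount_castE {p q : ℕ} (h : p = q) (l : Fin p → ℤ) : mcount (castE h l) = mcount l := by
  subst h; rfl

lemma sumz_castE {p q : ℕ} (h : p = q) (l : Fin p → ℤ) : sumz (castE h l) = sumz l := by
  subst h; rfl

lemma interP_castE {p q : ℕ} (h : p = q) (l : Fin (p + 1) → ℤ) (ν : Fin p → ℤ) :
    interP (castE h ν) (castE (congrArg (· + 1) h) l) ↔ interP ν l := by
  subst h; rfl

lemma HLP_eq_PP {K : Type} [Field K] (t : K) (μ : Fin 0 → ℤ) (k : ℕ) (l : Fin (0 + k) → ℤ) (x : Fin k → K) :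
    HLP t k μ l x = PP t k (castE (Nat.zero_add k) l) x := by
  induction k with
  | zero =>
    unfold HLP PP
    rw [if_pos]
    exact Subsingleton.elim _ _
  | succ k ih =>
    unfold HLP PP
    rw [← finsum_comp_equiv (castE (Nat.zero_add k)).symm, finsum_eq_sum_of_support_subset (s := DP _)]
    · apply Finset.sum_congr rfl
      intro ν hν
      rw [mem_DP] at hν
      rw [if_pos]
      · rw [ih, Equiv.apply_symm_apply]
        have e1 := mcount_castE (Nat.zero_add k) ((castE (Nat.zero_add k)).symm ν)
        have e2 := sumz_castE (Nat.zero_add k) ((castE (Nat.zero_add k)).symm ν)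
        rw [Equiv.apply_symm_apply] at e1 e2
        have e3 := mcount_castE (Nat.zero_add (k + 1)) l
        have e4 := sumz_castE (Nat.zero_add (k + 1)) l
        rw [e1, e2, e3, e4]
        rfl
      · rw [← interP_castE (Nat.zero_add k), Equiv.apply_symm_apply]
        exact hν
    · intro ν hν
      rw [Function.mem_support] at hν
      simp only [Finset.mem_coe, mem_DP]
      have := (ite_ne_right_iff.1 hν).1
      rw [← interP_castE (Nat.zero_add k), Equiv.apply_symm_apply] at this
      exact this

lemma HLPfull_eq {K : Type} [Field K] (t : K) {n : ℕ} (l : Fin n → ℤ) (x : Fin n → K) :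
    HLPfull t l x = PP t n l x := by
  unfold HLPfull
  rw [HLP_eq_PP]
  rfl

/-- One-variable generating series `(1 - t y X) / (1 - y X)`. -/
def Eg {K : Type*} [Field K] (t y : K) : PowerSeries K :=
  (1 - PowerSeries.C (t * y) * PowerSeries.X) * PowerSeries.mk (fun r => y ^ r)

lemma geom_inv {K : Type*} [Field K] (y : K) :
    (1 - PowerSeries.C y * PowerSeries.X) * PowerSeries.mk (fun r => y ^ r) = 1 := by
  ext r
  rw [sub_mul, one_mul, mul_assoc]
  rcases r with _ | r
  · simp
  · rw [map_sub, PowerSeries.coeff_C_mul, PowerSeries.coeff_succ_X_mul]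
    simp [pow_succ', PowerSeries.coeff_one]

lemma Eg_double {K : Type*} [Field K] (t y : K) : Eg t y * Eg t (y * t) = Eg (t ^ 2) y := by
  unfold Eg
  have h1 := geom_inv (t * y)
  have : y * t = t * y := mul_comm _ _
  rw [this]
  have e2 : t * (t * y) = t ^ 2 * y := by ring
  rw [e2]
  calc _ = ((1 - PowerSeries.C (t * y) * PowerSeries.X) * PowerSeries.mk (fun r => (t * y) ^ r)) *
    ((1 - PowerSeries.C (t ^ 2 * y) * PowerSeries.X) * PowerSeries.mk (fun r => y ^ r)) := by ring
    _ = _ := by rw [h1, one_mul]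

/-- The box containing all relevant intermediate signatures. -/
def BX {n : ℕ} (ν : Fin (n + 1) → ℤ) (N : ℕ) : Finset (Fin n → ℤ) :=
  Fintype.piFinset fun i : Fin n => Finset.Icc (ν i.succ) (ν i.castSucc + N)

lemma BX_L {n : ℕ} {ν l : Fin (n + 1) → ℤ} {μ : Fin n → ℤ} {N r : ℕ} (hr : r ≤ N) (hl : l ∈ UQ ν r)
    (hμ : interP μ l) : μ ∈ BX ν N := by
  rw [mem_UQ] at hl
  unfold BX
  rw [Fintype.mem_piFinset]
  intro i
  rw [Finset.mem_Icc]
  have a := hμ i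
  have b := hl.1.1 i.succ
  have c := le_of_sumz _ hl.1.1 hl.2.le i.castSucc
  omega

lemma BX_R {n : ℕ} {ν : Fin (n + 1) → ℤ} {κ μ : Fin n → ℤ} {N r : ℕ} (hr : r ≤ N) (hl : μ ∈ UQ κ r)
    (hμ : interP κ ν) : μ ∈ BX ν N := by
  rw [mem_UQ] at hl
  unfold BX
  rw [Fintype.mem_piFinset]
  intro i
  rw [Finset.mem_Icc]
  have a := hμ i
  have b := hl.1.1 i
  have c := le_of_sumz _ hl.1.1 hl.2.le i
  omega

/-- Right side of the Pieri rule. -/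
def Wr {K : Type*} [Field K] (t : K) {n : ℕ} (ν : Fin n → ℤ) (y : Fin n → K) (r : ℕ) : K :=
  ∑ l ∈ UQ ν r, gw t (mcount l) (mcount ν) * PP t n l y

lemma Wr_eq {K : Type*} [Field K] (t : K) {n : ℕ} (ν : Fin (n + 1) → ℤ) (y : Fin (n + 1) → K)
    (r N : ℕ) (hr : r ≤ N) :
    Wr t ν y r = ∑ μ ∈ BX ν N, PP t n μ (fun i => y i.castSucc) *
      y (Fin.last n) ^ (sumz ν + r - sumz μ) * Lc t μ ν r := by
  unfold Wr Lc
  simp only [Finset.mul_sum]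
  rw [Finset.sum_comm]
  apply Finset.sum_congr rfl
  intro l hl
  have e : sumz l = sumz ν + r := (mem_UQ.1 hl).2
  rw [PP, Finset.mul_sum]
  simp only [mul_ite, mul_zero]
  rw [← Finset.sum_filter]
  have hs : (BX ν N).filter (fun μ => interP μ l) = DP l := by
    ext μ
    rw [Finset.mem_filter, mem_DP]
    exact ⟨fun h => h.2, fun h => ⟨BX_L hr hl h, h⟩⟩
  rw [hs]
  apply Finset.sum_congr rfl
  intro μ _
  rw [e]
  ring

/-- Intermediate sum. -/
def Vr {K : Type*} [Field K] (t : K) {n : ℕ} (ν : Fin (n + 1) → ℤ) (y : Fin (n + 1) → K) (r : ℕ) : K :=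
  ∑ κ ∈ DP ν, gw t (mcount κ) (mcount ν) * y (Fin.last n) ^ (sumz ν - sumz κ)
    * Wr t κ (fun i => y i.castSucc) r

lemma Vr_eq {K : Type*} [Field K] (t : K) {n : ℕ} (ν : Fin (n + 1) → ℤ) (y : Fin (n + 1) → K)
    (r N : ℕ) (hr : r ≤ N) :
    Vr t ν y r = ∑ μ ∈ BX ν N, PP t n μ (fun i => y i.castSucc) *
      y (Fin.last n) ^ (sumz ν + r - sumz μ) * Rc t μ ν r := by
  unfold Vr Rc Wr
  simp only [Finset.mul_sum]
  rw [Finset.sum_comm]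
  apply Finset.sum_congr rfl
  intro κ hκ
  rw [mem_DP] at hκ
  simp only [mul_ite, mul_zero]
  rw [← Finset.sum_filter]
  have hs : (BX ν N).filter (fun μ => μ ∈ UQ κ r) = UQ κ r := by
    ext μ
    rw [Finset.mem_filter]
    exact ⟨fun h => h.2, fun h => ⟨BX_R hr h hκ, h⟩⟩
  rw [hs]
  apply Finset.sum_congr rfl
  intro μ hμ
  have e : sumz μ = sumz κ + r := (mem_UQ.1 hμ).2
  have e2 : sumz ν + r - sumz μ = sumz ν - sumz κ := by omega
  rw [e2]
  ring

theorem pieri {K : Type*} [Field K] (t : K) (n : ℕ) (ν : Fin n → ℤ) (hν : IsSig ν) (y : Fin n → K)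
    (hy : ∀ i, y i ≠ 0) :
    PowerSeries.C (PP t n ν y) * ∏ i, Eg t (y i) = PowerSeries.mk (Wr t ν y) := by
  induction n with
  | zero =>
    ext r
    simp only [PP, map_one, Finset.univ_eq_empty, Finset.prod_empty, mul_one, PowerSeries.coeff_mk, Wr]
    rw [PowerSeries.coeff_one]
    split_ifs with h
    · subst h
      have : UQ ν 0 = {ν} := by
        ext l
        rw [mem_UQ, Finset.mem_singleton]
        constructor
        · intro _; exact Subsingleton.elim _ _
        · rintro rfl; exact ⟨⟨fun i => le_rfl, fun i => i.elim0⟩, by simp⟩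
      rw [this, Finset.sum_singleton]
      unfold gw
      simp [mcount]
    · have : UQ ν r = ∅ := by
        ext l
        rw [mem_UQ]
        simp [sumz]
        intro _
        omega
      rw [this, Finset.sum_empty]
  | succ n ih =>
    have hV : PowerSeries.mk (Vr t ν y) = PowerSeries.C (PP t (n + 1) ν y) *
        ∏ i : Fin n, Eg t (y i.castSucc) := by
      rw [PP, map_sum, Finset.sum_mul]
      ext r
      rw [PowerSeries.coeff_mk, map_sum]
      unfold Vr
      apply Finset.sum_congr rfl
      intro κ hκ
      rw [mem_DP] at hκ
      rw [RingHom.map_mul, mul_assoc (PowerSeries.C _), ih κ (interP_sig hκ) _ (fun i => hy _), PowerSeries.coeff_C_mul,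
        PowerSeries.coeff_mk]
    have hWV : (1 - PowerSeries.C (y (Fin.last n)) * PowerSeries.X) * PowerSeries.mk (Wr t ν y)
        = (1 - PowerSeries.C (t * y (Fin.last n)) * PowerSeries.X) * PowerSeries.mk (Vr t ν y) := by
      have hy0 := hy (Fin.last n)
      ext r
      rw [sub_mul, sub_mul, one_mul, one_mul, mul_assoc, mul_assoc]
      rcases r with _ | r
      · simp only [map_sub, PowerSeries.coeff_C_mul, PowerSeries.coeff_zero_X_mul, PowerSeries.coeff_mk,
          mul_zero, sub_zero]
        rw [Wr_eq t ν y 0 0 le_rfl, Vr_eq t ν y 0 0 le_rfl]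
        apply Finset.sum_congr rfl
        intro μ _
        rw [(local_ident t μ ν hν).1]
      · rw [map_sub, map_sub, PowerSeries.coeff_C_mul, PowerSeries.coeff_C_mul, PowerSeries.coeff_succ_X_mul,
          PowerSeries.coeff_succ_X_mul]
        simp only [PowerSeries.coeff_mk]
        rw [Wr_eq t ν y (r + 1) (r + 1) le_rfl, Vr_eq t ν y (r + 1) (r + 1) le_rfl,
          Wr_eq t ν y r (r + 1) (by omega), Vr_eq t ν y r (r + 1) (by omega),
          Finset.mul_sum, Finset.mul_sum, ← Finset.sum_sub_distrib, ← Finset.sum_sub_distrib]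
        apply Finset.sum_congr rfl
        intro μ _
        have h := (local_ident t μ ν hν).2 r
        have e : y (Fin.last n) ^ (sumz ν + ((r + 1 : ℕ) : ℤ) - sumz μ)
            = y (Fin.last n) ^ (sumz ν + r - sumz μ) * y (Fin.last n) := by
          rw [← zpow_add_one₀ hy0]
          congr 1
          push_cast
          ring
        rw [e]
        linear_combination (PP t n μ (fun i => y i.castSucc) *
          y (Fin.last n) ^ (sumz ν + r - sumz μ) * y (Fin.last n)) * h
    rw [Fin.prod_univ_castSucc, ← mul_assoc, ← hV, Eg]
    calc _ = ((1 - PowerSeries.C (t * y (Fin.last n)) * PowerSeries.X) * PowerSeries.mk (Vr t ν y)) *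
        PowerSeries.mk (fun r => y (Fin.last n) ^ r) := by ring
      _ = PowerSeries.mk (Wr t ν y) * ((1 - PowerSeries.C (y (Fin.last n)) * PowerSeries.X) *
        PowerSeries.mk (fun r => y (Fin.last n) ^ r)) := by rw [← hWV]; ring
      _ = _ := by rw [geom_inv, mul_one]

/-- Signatures below `l` by a horizontal strip of size `r`. -/
def DQ {p : ℕ} (l : Fin p → ℤ) (r : ℕ) : Finset (Fin p → ℤ) :=
  (Fintype.piFinset fun i : Fin p => Finset.Icc (l i - r) (l i)).filter (fun κ => l ∈ UQ κ r)

lemma mem_DQ {p : ℕ} {κ l : Fin p → ℤ} {r : ℕ} : κ ∈ DQ l r ↔ l ∈ UQ κ r := by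
  unfold DQ
  rw [Finset.mem_filter, Fintype.mem_piFinset, and_iff_right_iff_imp]
  intro h i
  rw [mem_UQ] at h
  rw [Finset.mem_Icc]
  have a := h.1.1 i
  have b := le_of_sumz _ h.1.1 h.2.le i
  omega

/-- Coefficients of the skew `Q` polynomials. -/
def HQ {R : Type*} [CommRing R] (t : R) {n : ℕ} : (k : ℕ) → (Fin n → ℤ) → (Fin n → ℤ) → (Fin k → ℕ) → R
  | 0, ν, l, _ => if ν = l then 1 else 0
  | k + 1, ν, l, α => ∑ κ ∈ DQ l (α (Fin.last k)), gw t (mcount l) (mcount κ) *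
      HQ t k ν κ (fun i => α i.castSucc)

lemma HQ_map {R S : Type*} [CommRing R] [CommRing S] (f : R →+* S) (t : R) {n : ℕ} (k : ℕ)
    (ν l : Fin n → ℤ) (α : Fin k → ℕ) : f (HQ t k ν l α) = HQ (f t) k ν l α := by
  induction k generalizing l with
  | zero =>
    unfold HQ
    split_ifs <;> simp
  | succ k ih =>
    unfold HQ
    rw [map_sum]
    apply Finset.sum_congr rfl
    intro κ _
    rw [map_mul, gw_map, ih]

/-- Reachable signatures. -/
def CQ {n : ℕ} : (k : ℕ) → (Fin n → ℤ) → (Fin k → ℕ) → Finset (Fin n → ℤ)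
  | 0, ν, _ => {ν}
  | k + 1, ν, α => (CQ k ν (fun i => α i.castSucc)).biUnion (fun κ => UQ κ (α (Fin.last k)))

lemma HQ_support {R : Type*} [CommRing R] (t : R) {n : ℕ} (k : ℕ)
    (ν l : Fin n → ℤ) (α : Fin k → ℕ) (h : HQ t k ν l α ≠ 0) : l ∈ CQ k ν α := by
  induction k generalizing l with
  | zero =>
    unfold HQ at h
    have := (ite_ne_right_iff.1 h).1
    rw [CQ, this]
    simp
  | succ k ih =>
    unfold HQ at h
    obtain ⟨κ, hκ, h⟩ := Finset.exists_ne_zero_of_sum_ne_zero h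
    rw [CQ, Finset.mem_biUnion]
    exact ⟨κ, ih κ _ (right_ne_zero_of_mul h), mem_DQ.1 hκ⟩

lemma CQ_prop {n : ℕ} (k : ℕ) (ν l : Fin n → ℤ) (hν : IsSig ν) (α : Fin k → ℕ) (h : l ∈ CQ k ν α) :
    IsSig l ∧ ∀ i, ν i ≤ l i := by
  induction k generalizing l with
  | zero =>
    rw [CQ, Finset.mem_singleton] at h
    subst h
    exact ⟨hν, fun i => le_rfl⟩
  | succ k ih =>
    rw [CQ, Finset.mem_biUnion] at h
    obtain ⟨κ, h1, h2⟩ := h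
    have a := ih κ _ h1
    have b := (mem_UQ.1 h2).1
    exact ⟨interQ_sig_right b, fun i => (a.2 i).trans (b.1 i)⟩

lemma CQ_sumz {n : ℕ} (k : ℕ) (ν l : Fin n → ℤ) (α : Fin k → ℕ) (h : l ∈ CQ k ν α) :
    sumz ν ≤ sumz l := by
  induction k generalizing l with
  | zero =>
    rw [CQ, Finset.mem_singleton] at h
    subst h
    exact le_rfl
  | succ k ih =>
    rw [CQ, Finset.mem_biUnion] at h
    obtain ⟨κ, h1, h2⟩ := h
    have a := ih κ _ h1
    have b := (mem_UQ.1 h2).2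
    omega

/-- One row functions. -/
def qf {K : Type*} [Field K] (t : K) {n : ℕ} (y : Fin n → K) (r : ℕ) : K :=
  PowerSeries.coeff r (∏ i, Eg t (y i))

lemma pieri_coeff {K : Type*} [Field K] (t : K) {n : ℕ} (ν : Fin n → ℤ) (hν : IsSig ν) (y : Fin n → K)
    (hy : ∀ i, y i ≠ 0) (r : ℕ) : PP t n ν y * qf t y r = Wr t ν y r := by
  have := congrArg (PowerSeries.coeff r) (pieri t n ν hν y hy)
  rw [PowerSeries.coeff_C_mul, PowerSeries.coeff_mk] at this
  exact this

lemma pieri_iter {K : Type*} [Field K] (t : K) {n : ℕ} (ν : Fin n → ℤ) (hν : IsSig ν) (y : Fin n → K)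
    (hy : ∀ i, y i ≠ 0) (k : ℕ) (α : Fin k → ℕ) :
    PP t n ν y * ∏ i, qf t y (α i) = ∑ l ∈ CQ k ν α, HQ t k ν l α * PP t n l y := by
  induction k with
  | zero =>
    simp [CQ, HQ]
  | succ k ih =>
    rw [Fin.prod_univ_castSucc, ← mul_assoc, ih]
    have h1 : ∀ l ∈ CQ (k + 1) ν α, HQ t (k + 1) ν l α * PP t n l y =
        ∑ κ ∈ CQ k ν (fun i => α i.castSucc), if l ∈ UQ κ (α (Fin.last k)) then
          HQ t k ν κ (fun i => α i.castSucc) * (gw t (mcount l) (mcount κ) * PP t n l y) else 0 := by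
      intro l _
      rw [← Finset.sum_filter, HQ, Finset.sum_mul]
      symm
      apply Finset.sum_subset_zero_on_sdiff
      · intro κ hκ
        exact mem_DQ.2 (Finset.mem_filter.1 hκ).2
      · intro κ hκ
        rw [Finset.mem_sdiff, mem_DQ, Finset.mem_filter] at hκ
        have : HQ t k ν κ (fun i => α i.castSucc) = 0 := by
          by_contra hne
          exact hκ.2 ⟨HQ_support t k ν κ _ hne, hκ.1⟩
        rw [this]
        ring
      · intro κ _
        ring
    rw [Finset.sum_congr rfl h1, Finset.sum_comm, Finset.sum_mul]
    apply Finset.sum_congr rfl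
    intro κ hκ
    rw [← Finset.sum_filter]
    have hs : (CQ (k + 1) ν α).filter (fun l => l ∈ UQ κ (α (Fin.last k))) = UQ κ (α (Fin.last k)) := by
      ext l
      rw [Finset.mem_filter]
      refine ⟨fun h => h.2, fun h => ⟨?_, h⟩⟩
      rw [CQ, Finset.mem_biUnion]
      exact ⟨κ, hκ, h⟩
    rw [hs, ← Finset.mul_sum, mul_assoc, pieri_coeff t κ (CQ_prop k ν κ hν _ hκ).1 y hy]
    rfl

lemma HLQ_eq {K : Type} [Field K] (t : K) {n : ℕ} (k : ℕ) (ν l : Fin n → ℤ) (x : Fin k → K) (N : ℕ)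
    (hN : sumz l - sumz ν ≤ N) :
    HLQ t k ν l x = ∑ α : Fin k → Fin (N + 1), HQ t k ν l (fun i => (α i : ℕ)) * ∏ i, x i ^ (α i : ℕ) := by
  induction k generalizing l N with
  | zero =>
    simp [HLQ, HQ]
  | succ k ih =>
    have hsum : ∀ f : (Fin (k + 1) → Fin (N + 1)) → K, ∑ α, f α
        = ∑ a : Fin (N + 1), ∑ β : Fin k → Fin (N + 1), f (Fin.snoc (α := fun _ => Fin (N + 1)) β a) := by
      intro f
      rw [← Finset.sum_product', ← (Fin.snocEquiv (fun _ => Fin (N + 1))).sum_comp]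
      rfl
    rw [hsum]
    have hterm : ∀ a : Fin (N + 1), ∑ β : Fin k → Fin (N + 1),
        HQ t (k + 1) ν l (fun i => ((Fin.snoc (α := fun _ => Fin (N + 1)) β a i : Fin (N + 1)) : ℕ)) *
          ∏ i, x i ^ ((Fin.snoc (α := fun _ => Fin (N + 1)) β a i : Fin (N + 1)) : ℕ)
        = ∑ κ ∈ DQ l a, if interQ κ l then phiHL t l κ * x (Fin.last k) ^ (sumz l - sumz κ) *
            HLQ t k ν κ (fun i => x i.castSucc) else 0 := by
      intro a
      simp only [HQ, Fin.snoc_last, Fin.snoc_castSucc, Finset.sum_mul, Fin.prod_univ_castSucc]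
      rw [Finset.sum_comm]
      apply Finset.sum_congr rfl
      intro κ hκ
      rw [mem_DQ, mem_UQ] at hκ
      rw [if_pos hκ.1, ih κ _ N (by have := hκ.2; omega), Finset.mul_sum]
      apply Finset.sum_congr rfl
      intro β _
      have e : sumz l - sumz κ = ((a : ℕ) : ℤ) := by have := hκ.2; omega
      rw [e, zpow_natCast]
      unfold phiHL gw
      ring
    rw [Finset.sum_congr rfl (fun a _ => hterm a), ← Finset.sum_biUnion]
    · rw [HLQ]
      apply finsum_eq_sum_of_support_subset
      intro κ hκ
      rw [Function.mem_support] at hκ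
      obtain ⟨h1, h2⟩ := ite_ne_right_iff.1 hκ
      have h3 := right_ne_zero_of_mul h2
      rw [ih κ _ (sumz κ - sumz ν).toNat (by omega)] at h3
      obtain ⟨α, -, h4⟩ := Finset.exists_ne_zero_of_sum_ne_zero h3
      have h5 := CQ_sumz k ν κ _ (HQ_support t k ν κ _ (left_ne_zero_of_mul h4))
      have h6 := sumz_mono h1.1
      rw [Finset.mem_coe, Finset.mem_biUnion]
      refine ⟨⟨(sumz l - sumz κ).toNat, by omega⟩, Finset.mem_univ _, ?_⟩
      rw [mem_DQ, mem_UQ]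
      refine ⟨h1, ?_⟩
      simp only
      omega
    · intro a _ b _ hab
      rw [Function.onFun, Finset.disjoint_left]
      intro κ h1 h2
      rw [mem_DQ, mem_UQ] at h1 h2
      apply hab
      apply Fin.ext
      omega

lemma gw_one {R : Type*} [CommRing R] (t : R) (A B : ℤ → ℕ) (h : ∀ c, A c ≤ B c) : gw t A B = 1 := by
  unfold gw
  rw [finprod_congr (g := fun _ => 1), finprod_one]
  intro c
  rw [if_neg]
  have := h c
  omega

lemma mcount_init {n : ℕ} (l : Fin (n + 1) → ℤ) (c : ℤ) :
    mcount (fun i : Fin n => l i.castSucc) c ≤ mcount l c := by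
  unfold mcount
  rw [← Finset.card_map Fin.castSuccEmb]
  apply Finset.card_le_card
  intro j hj
  rw [Finset.mem_map] at hj
  obtain ⟨i, hi, rfl⟩ := hj
  simpa using hi

lemma PP_zero {K : Type*} [Field K] (t : K) (n : ℕ) (y : Fin n → K) :
    PP t n (fun _ => 0) y = 1 := by
  induction n with
  | zero => rfl
  | succ n ih =>
    have : DP (fun _ : Fin (n + 1) => (0 : ℤ)) = {fun _ => 0} := by
      ext κ
      rw [mem_DP, Finset.mem_singleton]
      constructor
      · intro h
        funext i
        exact le_antisymm (h i).1 (h i).2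
      · rintro rfl i
        simp
    rw [PP, this, Finset.sum_singleton, ih]
    have h2 := gw_one t (mcount (fun _ : Fin n => (0 : ℤ))) (mcount (fun _ : Fin (n + 1) => (0 : ℤ)))
      (fun c => mcount_init (fun _ : Fin (n + 1) => (0 : ℤ)) c)
    rw [h2]
    simp [sumz]

lemma PP_smul {K : Type*} [Field K] (t s : K) (hs : s ≠ 0) (n : ℕ) (l : Fin n → ℤ) (y : Fin n → K) :
    PP t n l (fun i => s * y i) = s ^ sumz l * PP t n l y := by
  induction n with
  | zero => simp [PP, sumz]
  | succ n ih =>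
    rw [PP, PP, Finset.mul_sum]
    apply Finset.sum_congr rfl
    intro κ _
    rw [ih, mul_zpow]
    have : s ^ sumz l = s ^ (sumz l - sumz κ) * s ^ sumz κ := by
      rw [← zpow_add₀ hs]; congr 1; ring
    rw [this]
    ring

lemma sumz_castSucc {n : ℕ} (l : Fin (n + 1) → ℤ) :
    sumz l = sumz (fun i : Fin n => l i.castSucc) + l (Fin.last n) := by
  unfold sumz
  rw [Fin.sum_univ_castSucc]

theorem PP_indep {K : Type*} [Field K] [Infinite K] (t : K) (n : ℕ) (S : Finset (Fin n → ℤ))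
    (hS : ∀ l ∈ S, IsSig l) (a : (Fin n → ℤ) → K)
    (h : ∀ y : Fin n → K, (∀ i, y i ≠ 0) → ∑ l ∈ S, a l * PP t n l y = 0) : ∀ l ∈ S, a l = 0 := by
  induction n with
  | zero =>
    intro l hl
    have hSl : S = {l} := by
      ext l'
      rw [Finset.mem_singleton]
      exact ⟨fun _ => Subsingleton.elim _ _, fun h => h ▸ hl⟩
    have := h (fun i => i.elim0) (fun i => i.elim0)
    rw [hSl, Finset.sum_singleton] at this
    simpa [PP] using this
  | succ n ih =>
    by_contra hcon
    push Not at hcon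
    obtain ⟨l0, hl0, hal0⟩ := hcon
    let S' := S.filter (fun l => a l ≠ 0)
    have hne : S'.Nonempty := ⟨l0, Finset.mem_filter.2 ⟨hl0, hal0⟩⟩
    obtain ⟨lm, hlm, hmin⟩ := Finset.exists_min_image S' (fun l => l (Fin.last n)) hne
    have hsum' : ∀ y : Fin (n + 1) → K, (∀ i, y i ≠ 0) → ∑ l ∈ S', a l * PP t (n + 1) l y = 0 := by
      intro y hy
      rw [← h y hy]
      apply Finset.sum_subset (Finset.filter_subset _ _)
      intro l hl hl'
      have : a l = 0 := by
        by_contra hh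
        exact hl' (Finset.mem_filter.2 ⟨hl, hh⟩)
      rw [this, zero_mul]
    have hsig : ∀ l ∈ S', IsSig l := fun l hl => hS l (Finset.mem_filter.1 hl).1
    set m := lm (Fin.last n) with hm
    let T := S'.filter (fun l => l (Fin.last n) = m)
    have hexp : ∀ l ∈ S', ∀ κ ∈ DP l, 0 ≤ sumz l - sumz κ - m ∧
        (sumz l - sumz κ - m = 0 ↔ l (Fin.last n) = m ∧ κ = fun i => l i.castSucc) := by
      intro l hl κ hκ
      rw [mem_DP] at hκ
      have h1 := sumz_castSucc l
      have h2 : ∀ i, κ i ≤ l i.castSucc := fun i => (hκ i).1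
      have h3 : sumz κ ≤ sumz (fun i : Fin n => l i.castSucc) := sumz_mono h2
      have h4 : m ≤ l (Fin.last n) := hmin l hl
      refine ⟨by omega, ?_, ?_⟩
      · intro h5
        refine ⟨by omega, ?_⟩
        funext i
        have := le_of_sumz (ν := κ) (l := fun i : Fin n => l i.castSucc) 0 h2 (by omega) i
        have := h2 i
        omega
      · rintro ⟨h5, h6⟩
        rw [h6]
        omega
    have key : ∀ y : Fin n → K, (∀ i, y i ≠ 0) → ∑ l ∈ T, a l * PP t n (fun i => l i.castSucc) y = 0 := by
      intro y hy
      let p : Polynomial K := ∑ l ∈ S', ∑ κ ∈ DP l,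
        Polynomial.C (a l * (gw t (mcount κ) (mcount l) * PP t n κ y)) *
          Polynomial.X ^ (sumz l - sumz κ - m).toNat
      have hp : ∀ s : K, s ≠ 0 → p.eval s = 0 := by
        intro s hs
        have h1 := hsum' (Fin.snoc (α := fun _ => K) y s) (by
          intro i
          refine Fin.lastCases ?_ (fun j => ?_) i
          · simpa using hs
          · simpa using hy j)
        have h2 : s ^ (-m) * ∑ l ∈ S', a l * PP t (n + 1) l (Fin.snoc (α := fun _ => K) y s) = p.eval s := by
          simp only [p, Polynomial.eval_finsetSum]
          rw [Finset.mul_sum]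
          apply Finset.sum_congr rfl
          intro l hl
          rw [PP, Finset.mul_sum, Finset.mul_sum]
          apply Finset.sum_congr rfl
          intro κ hκ
          have h3 := (hexp l hl κ hκ).1
          have h4 : s ^ (sumz l - sumz κ) = s ^ m * s ^ (sumz l - sumz κ - m).toNat := by
            rw [← zpow_natCast, ← zpow_add₀ hs]
            congr 1
            omega
          simp only [Fin.snoc_last, Fin.snoc_castSucc, Polynomial.eval_mul, Polynomial.eval_C,
            Polynomial.eval_pow, Polynomial.eval_X]
          rw [h4, zpow_neg]
          have h5 : s ^ m ≠ 0 := zpow_ne_zero m hs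
          field_simp
        rw [← h2, h1, mul_zero]
      have hp0 : p = 0 := by
        have : Polynomial.X * p = 0 := by
          apply Polynomial.funext
          intro s
          by_cases hs : s = 0
          · simp [hs]
          · simp [hp s hs]
        rcases mul_eq_zero.1 this with h | h
        · exact absurd h Polynomial.X_ne_zero
        · exact h
      have hc : p.coeff 0 = 0 := by rw [hp0]; simp
      rw [← hc]
      simp only [p, Polynomial.finsetSum_coeff, Polynomial.coeff_C_mul, Polynomial.coeff_X_pow]
      rw [Finset.sum_filter]
      apply Finset.sum_congr rfl
      intro l hl
      have hl' : (fun i : Fin n => l i.castSucc) ∈ DP l := by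
        rw [mem_DP]
        intro i
        exact ⟨le_rfl, hsig l hl _ _ (Fin.castSucc_lt_succ).le⟩
      rw [Finset.sum_eq_single (fun i : Fin n => l i.castSucc)]
      · have h1 := hexp l hl _ hl'
        rw [gw_one t _ _ (mcount_init l)]
        by_cases h2 : l (Fin.last n) = m
        · rw [if_pos h2, if_pos]
          · ring
          · have := h1.2.2 ⟨h2, rfl⟩
            omega
        · rw [if_neg h2, if_neg, mul_zero]
          intro h3
          exact h2 (h1.2.1 (by omega)).1
      · intro κ hκ hne
        have h1 := hexp l hl κ hκ
        rw [if_neg, mul_zero]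
        intro h3
        exact hne (h1.2.1 (by omega)).2
      · intro h1
        exact absurd hl' h1
    let ini : (Fin (n + 1) → ℤ) → (Fin n → ℤ) := fun l i => l i.castSucc
    have hrec : ∀ l ∈ T, l = Fin.snoc (α := fun _ => ℤ) (ini l) m := by
      intro l hl
      have : l (Fin.last n) = m := (Finset.mem_filter.1 hl).2
      funext i
      refine Fin.lastCases ?_ (fun j => ?_) i
      · simpa using this
      · simp [ini]
    have hinj : ∀ l ∈ T, ∀ l' ∈ T, ini l = ini l' → l = l' := by
      intro l hl l' hl' he
      rw [hrec l hl, hrec l' hl', he]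
    have hfin := ih (T.image ini) (by
        intro κ hκ
        obtain ⟨l, hl, rfl⟩ := Finset.mem_image.1 hκ
        intro i j hij
        exact hsig l (Finset.mem_filter.1 hl).1 _ _ (by simpa using hij))
      (fun κ => a (Fin.snoc (α := fun _ => ℤ) κ m)) (by
        intro y hy
        rw [Finset.sum_image (fun l hl l' hl' => hinj l hl l' hl')]
        rw [← key y hy]
        apply Finset.sum_congr rfl
        intro l hl
        rw [← hrec l hl])
    have hlmT : lm ∈ T := Finset.mem_filter.2 ⟨hlm, rfl⟩
    have := hfin (ini lm) (Finset.mem_image_of_mem _ hlmT)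
    rw [← hrec lm hlmT] at this
    exact (Finset.mem_filter.1 hlm).2 this

lemma prod_double {M : Type*} [CommMonoid M] (f : ℕ → ℕ → M) (n : ℕ) :
    ∏ i : Fin (2 * n), f ((i : ℕ) / 2) ((i : ℕ) % 2) = ∏ j : Fin n, (f j 0 * f j 1) := by
  rw [Fin.prod_univ_eq_prod_range (fun i => f (i / 2) (i % 2)),
    Fin.prod_univ_eq_prod_range (fun j => f j 0 * f j 1)]
  induction n with
  | zero => simp
  | succ n ih =>
    rw [show 2 * (n + 1) = 2 * n + 1 + 1 by ring, Finset.prod_range_succ, Finset.prod_range_succ, ih,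
      Finset.prod_range_succ, mul_assoc]
    congr 3 <;> omega

lemma Eg_doubleList {K : Type} [Field K] (t : K) {n : ℕ} (y : Fin n → K) :
    ∏ i, Eg t (doubleList t y i) = ∏ i, Eg (t ^ 2) (y i) := by
  have h := prod_double (fun a b => Eg t ((if h : a < n then y ⟨a, h⟩ else 1) * t ^ b)) n
  have e1 : ∏ i, Eg t (doubleList t y i) = ∏ i : Fin (2 * n),
      Eg t ((if h : (i : ℕ) / 2 < n then y ⟨(i : ℕ) / 2, h⟩ else 1) * t ^ ((i : ℕ) % 2)) := by
    apply Finset.prod_congr rfl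
    intro i _
    rw [dif_pos (by omega)]
    rfl
  rw [e1, h]
  apply Finset.prod_congr rfl
  intro j _
  rw [dif_pos j.isLt, pow_zero, mul_one, pow_one, Eg_double]

lemma doubleList_ne {K : Type} [Field K] (t : K) (ht : t ≠ 0) {n : ℕ} (y : Fin n → K) (hy : ∀ i, y i ≠ 0) (i) :
    doubleList t y i ≠ 0 := mul_ne_zero (hy _) (pow_ne_zero _ ht)

lemma doubleList_smul {K : Type} [Field K] (t s : K) {n : ℕ} (y : Fin n → K) :
    doubleList t (fun i => s * y i) = fun i => s * doubleList t y i := by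
  funext i
  unfold doubleList
  ring

/-- Expansion rewritten with `PP` over a field containing `ℤ[X]`. -/
lemma alt_PP {n : ℕ} {μ : Fin (2 * n) → ℤ} {ν : Fin n → ℤ} {c : (Fin n → ℤ) → Polynomial ℤ}
    (h : altExpand n μ ν c) {K : Type} [Field K] (t : K) (x : Fin n → K) (hx : ∀ i, x i ≠ 0)
    (S : Finset (Fin n → ℤ)) (hS : ∀ l, c l ≠ 0 → l ∈ S) :
    PP t (2 * n) μ (doubleList t x) * PP (t ^ 2) n ν x =
      ∑ l ∈ S, Polynomial.aeval t (c l) * PP (t ^ 2) n l x := by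
  have := h.2.2 K t x hx
  simp only [HLPfull_eq] at this
  rw [this]
  apply finsum_eq_sum_of_support_subset
  intro l hl
  rw [Function.mem_support] at hl
  apply hS
  intro h0
  apply hl
  rw [h0]
  simp

/-- The generic field. -/
def LF : Type := FractionRing (Polynomial ℤ)

instance fieldLF : Field LF := inferInstanceAs (Field (FractionRing (Polynomial ℤ)))

/-- The embedding of `ℤ[X]`. -/
def iL : Polynomial ℤ →+* LF := algebraMap (Polynomial ℤ) (FractionRing (Polynomial ℤ))

/-- The generic parameter. -/
def tX : LF := iL Polynomial.X

lemma aeval_tX (p : Polynomial ℤ) : Polynomial.aeval tX p = iL p := by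
  have : (Polynomial.aeval tX : Polynomial ℤ →ₐ[ℤ] LF).toRingHom = iL := by
    apply Polynomial.ringHom_ext'
    · exact Subsingleton.elim _ _
    · exact Polynomial.aeval_X tX
  exact congrArg (fun f : Polynomial ℤ →+* LF => f p) this

lemma algL_inj : Function.Injective iL :=
  IsFractionRing.injective (Polynomial ℤ) (FractionRing (Polynomial ℤ))

lemma tX_ne : tX ≠ 0 := by
  unfold tX
  rw [Ne, map_eq_zero_iff _ algL_inj]
  exact Polynomial.X_ne_zero

instance charZeroLF : CharZero LF := by
  have : Function.Injective (iL.comp (Polynomial.C : ℤ →+* Polynomial ℤ)) :=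
    algL_inj.comp Polynomial.C_injective
  exact charZero_of_injective_ringHom this

lemma two_zpow_inj {a b : ℤ} (h : (2 : LF) ^ a = 2 ^ b) : a = b := by
  have h2 : (((2 : ℚ) ^ a : ℚ) : LF) = (((2 : ℚ) ^ b : ℚ) : LF) := by
    push_cast
    exact h
  have h3 := Rat.cast_injective h2
  exact zpow_right_injective₀ (by norm_num) (by norm_num) h3

lemma alt_degree {n : ℕ} {μ : Fin (2 * n) → ℤ} {ν : Fin n → ℤ} {c : (Fin n → ℤ) → Polynomial ℤ}
    (h : altExpand n μ ν c) (l : Fin n → ℤ) (hl : c l ≠ 0) : sumz l = sumz μ + sumz ν := by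
  have hS : ∀ l, c l ≠ 0 → l ∈ h.1.toFinset := by
    intro l hl
    simpa using hl
  have hind := PP_indep (tX ^ 2) n h.1.toFinset (fun l hl => h.2.1 l (by simpa using hl))
    (fun l => Polynomial.aeval tX (c l) * ((2 : LF) ^ sumz l - 2 ^ (sumz μ + sumz ν))) (by
      intro y hy
      have two : (2 : LF) ≠ 0 := two_ne_zero
      have e1 := alt_PP h tX y hy _ hS
      have e2 := alt_PP h tX (fun i => 2 * y i) (fun i => mul_ne_zero two (hy i)) _ hS
      rw [doubleList_smul, PP_smul _ _ two, PP_smul _ _ two] at e2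
      have e3 : ∀ l, PP (tX ^ 2) n l (fun i => 2 * y i) = 2 ^ sumz l * PP (tX ^ 2) n l y :=
        fun l => PP_smul _ _ two _ _ _
      simp only [e3] at e2
      have e4 : ∑ l ∈ h.1.toFinset, Polynomial.aeval tX (c l) * ((2 : LF) ^ sumz l - 2 ^ (sumz μ + sumz ν)) *
          PP (tX ^ 2) n l y = ∑ l ∈ h.1.toFinset, Polynomial.aeval tX (c l) * (2 ^ sumz l * PP (tX ^ 2) n l y)
          - 2 ^ (sumz μ + sumz ν) * ∑ l ∈ h.1.toFinset, Polynomial.aeval tX (c l) * PP (tX ^ 2) n l y := by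
        rw [Finset.mul_sum, ← Finset.sum_sub_distrib]
        apply Finset.sum_congr rfl
        intro l _
        ring
      rw [e4, ← e1, ← e2, zpow_add₀ two]
      ring) l (hS l hl)
  rcases mul_eq_zero.1 hind with h1 | h1
  · rw [aeval_tX, map_eq_zero_iff _ algL_inj] at h1
    exact absurd h1 hl
  · exact two_zpow_inj (sub_eq_zero.1 h1)

lemma isSig_zero {p : ℕ} : IsSig (fun _ : Fin p => (0 : ℤ)) := fun _ _ _ => le_rfl

lemma main_generic {n m : ℕ} (l ν : Fin n → ℤ) (hl : IsSig l) (hν : IsSig ν)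
    (c : (Fin (2 * n) → ℤ) → (Fin n → ℤ) → Polynomial ℤ)
    (hc : ∀ μ : Fin (2 * n) → ℤ, IsSig μ → (∀ i, 0 ≤ μ i) → altExpand n μ ν (c μ)) (α : Fin m → ℕ) :
    ∑ μ ∈ CQ m (fun _ => 0) α, Polynomial.aeval tX (c μ l) * HQ tX m (fun _ => 0) μ α
      = HQ (tX ^ 2) m ν l α := by
  have hμ : ∀ μ ∈ CQ m (fun _ : Fin (2 * n) => (0 : ℤ)) α, altExpand n μ ν (c μ) := by
    intro μ h
    have := CQ_prop m _ μ isSig_zero α h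
    exact hc μ this.1 this.2
  let A : Finset (Fin n → ℤ) := ((CQ m (fun _ : Fin (2 * n) => (0 : ℤ)) α).attach.biUnion
    fun μ => (hμ μ.1 μ.2).1.toFinset) ∪ CQ m ν α ∪ {l}
  have hA1 : ∀ μ ∈ CQ m (fun _ : Fin (2 * n) => (0 : ℤ)) α, ∀ κ, c μ κ ≠ 0 → κ ∈ A := by
    intro μ h κ hκ
    apply Finset.mem_union_left
    apply Finset.mem_union_left
    rw [Finset.mem_biUnion]
    exact ⟨⟨μ, h⟩, Finset.mem_attach _ _, by simpa using hκ⟩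
  have hA2 : CQ m ν α ⊆ A := fun κ hκ => Finset.mem_union_left _ (Finset.mem_union_right _ hκ)
  have hA3 : l ∈ A := Finset.mem_union_right _ (Finset.mem_singleton_self _)
  have hAs : ∀ κ ∈ A, IsSig κ := by
    intro κ hκ
    rcases Finset.mem_union.1 hκ with hκ | hκ
    · rcases Finset.mem_union.1 hκ with hκ | hκ
      · obtain ⟨μ, -, h⟩ := Finset.mem_biUnion.1 hκ
        exact (hμ μ.1 μ.2).2.1 κ (by simpa using h)
      · exact (CQ_prop m ν κ hν α hκ).1
    · rw [Finset.mem_singleton.1 hκ]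
      exact hl
  have hind := PP_indep (tX ^ 2) n A hAs
    (fun κ => ∑ μ ∈ CQ m (fun _ => 0) α, Polynomial.aeval tX (c μ κ) * HQ tX m (fun _ => 0) μ α
      - HQ (tX ^ 2) m ν κ α) (by
    intro y hy
    have e1 := pieri_iter (tX ^ 2) ν hν y hy m α
    have e2 := pieri_iter tX (fun _ : Fin (2 * n) => (0 : ℤ)) isSig_zero (doubleList tX y)
      (doubleList_ne tX tX_ne y hy) m α
    have hq : ∀ r, qf tX (doubleList tX y) r = qf (tX ^ 2) y r := by
      intro r
      unfold qf
      rw [Eg_doubleList]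
    simp only [hq] at e2
    rw [PP_zero, one_mul] at e2
    rw [Finset.sum_subset hA2 (fun κ _ hκ => by
      have : HQ (tX ^ 2) m ν κ α = 0 := by
        by_contra hne
        exact hκ (HQ_support _ _ _ _ _ hne)
      rw [this, zero_mul])] at e1
    simp only [sub_mul]
    rw [Finset.sum_sub_distrib, ← e1, e2, Finset.mul_sum, sub_eq_zero]
    simp only [Finset.sum_mul]
    rw [Finset.sum_comm]
    apply Finset.sum_congr rfl
    intro μ h
    have e3 := alt_PP (hμ μ h) tX y hy A (hA1 μ h)
    calc _ = HQ tX m (fun _ => 0) μ α * ∑ κ ∈ A, Polynomial.aeval tX (c μ κ) * PP (tX ^ 2) n κ y := by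
          rw [Finset.mul_sum]
          apply Finset.sum_congr rfl
          intro κ _
          ring
      _ = _ := by
          rw [← e3]
          ring) l hA3
  exact sub_eq_zero.1 hind

lemma main_coeff {n m : ℕ} (l ν : Fin n → ℤ) (hl : IsSig l) (hν : IsSig ν)
    (c : (Fin (2 * n) → ℤ) → (Fin n → ℤ) → Polynomial ℤ)
    (hc : ∀ μ : Fin (2 * n) → ℤ, IsSig μ → (∀ i, 0 ≤ μ i) → altExpand n μ ν (c μ)) (α : Fin m → ℕ)
    {K : Type} [Field K] (t : K) :
    ∑ μ ∈ CQ m (fun _ => 0) α, Polynomial.aeval t (c μ l) * HQ t m (fun _ => 0) μ α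
      = HQ (t ^ 2) m ν l α := by
  have h1 : ∑ μ ∈ CQ m (fun _ => 0) α, c μ l * HQ Polynomial.X m (fun _ => 0) μ α
      = HQ (Polynomial.X ^ 2) m ν l α := by
    apply algL_inj
    rw [map_sum, HQ_map, map_pow]
    refine Eq.trans ?_ (main_generic l ν hl hν c hc α)
    apply Finset.sum_congr rfl
    intro μ _
    rw [map_mul, HQ_map, aeval_tX]
    rfl
  have h2 := congrArg (Polynomial.aeval t : Polynomial ℤ →ₐ[ℤ] K).toRingHom h1
  rw [map_sum, HQ_map, map_pow] at h2
  have e : (Polynomial.aeval t : Polynomial ℤ →ₐ[ℤ] K).toRingHom Polynomial.X = t := Polynomial.aeval_X t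
  rw [e] at h2
  rw [← h2]
  apply Finset.sum_congr rfl
  intro μ _
  rw [map_mul, HQ_map, e]
  rfl

/-- for the alternating Littlewood–Richardson coefficients `c_{μ,ν}^{alt,κ}(t)`,
`∑_{μ ∈ Sig_{2n}⁺} c_{μ,ν}^{alt,λ}(t) Q_{μ/0[2n]}(x₁,…,x_m;t) = Q_{λ/ν}(x₁,…,x_m;t²)`
as Laurent polynomials in `x₁,…,x_m` with coefficients in `ℤ[t]`. -/
theorem stmt16 (n m : ℕ) (hn : 1 ≤ n) (hm : 1 ≤ m)
    (l ν : Fin n → ℤ) (hl : IsSig l) (hν : IsSig ν)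
    (c : (Fin (2 * n) → ℤ) → (Fin n → ℤ) → Polynomial ℤ)
    (hc : ∀ μ : Fin (2 * n) → ℤ, IsSig μ → (∀ i, 0 ≤ μ i) → altExpand n μ ν (c μ))
    (K : Type) [Field K] (t : K) (x : Fin m → K) (hx : ∀ i, x i ≠ 0) :
    (∑ᶠ μ : Fin (2 * n) → ℤ,
        if IsSig μ ∧ ∀ i, 0 ≤ μ i then
          Polynomial.aeval t (c μ l) * HLQ t m (fun _ => 0) μ x
        else 0)
      = HLQ (t ^ 2) m ν l x := by
  set N : ℕ := (sumz l - sumz ν).toNat with hN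
  let M : Finset (Fin (2 * n) → ℤ) := (Fintype.piFinset fun _ : Fin (2 * n) => Finset.Icc (0 : ℤ) N).filter
    (fun μ => IsSig μ ∧ (∀ i, 0 ≤ μ i) ∧ sumz μ = sumz l - sumz ν)
  have hz : sumz (fun _ : Fin (2 * n) => (0 : ℤ)) = 0 := by simp [sumz]
  have hM : ∀ μ : Fin (2 * n) → ℤ, μ ∈ M ↔ (IsSig μ ∧ (∀ i, 0 ≤ μ i) ∧ sumz μ = sumz l - sumz ν) := by
    intro μ
    simp only [M]
    rw [Finset.mem_filter, Fintype.mem_piFinset, and_iff_right_iff_imp]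
    rintro ⟨-, h2, h3⟩ i
    rw [Finset.mem_Icc]
    have := le_of_sumz (ν := fun _ : Fin (2 * n) => (0 : ℤ)) (l := μ) N h2 (by omega) i
    exact ⟨h2 i, by omega⟩
  have hmem : ∀ μ : Fin (2 * n) → ℤ, IsSig μ → (∀ i, 0 ≤ μ i) → c μ l ≠ 0 → μ ∈ M := by
    intro μ h1 h2 h3
    rw [hM]
    have := alt_degree (hc μ h1 h2) l h3
    exact ⟨h1, h2, by omega⟩
  rw [finsum_eq_sum_of_support_subset (s := M)]
  · have h1 : ∀ μ ∈ M, (if IsSig μ ∧ ∀ i, 0 ≤ μ i then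
          Polynomial.aeval t (c μ l) * HLQ t m (fun _ => 0) μ x else 0)
        = ∑ α : Fin m → Fin (N + 1), (Polynomial.aeval t (c μ l) *
          HQ t m (fun _ => 0) μ (fun i => (α i : ℕ))) * ∏ i, x i ^ (α i : ℕ) := by
      intro μ hμ
      rw [hM] at hμ
      rw [if_pos ⟨hμ.1, hμ.2.1⟩, HLQ_eq t m _ μ x N (by have := hμ.2.2; omega), Finset.mul_sum]
      apply Finset.sum_congr rfl
      intro α _
      ring
    rw [Finset.sum_congr rfl h1, Finset.sum_comm, HLQ_eq (t ^ 2) m ν l x N (by omega)]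
    apply Finset.sum_congr rfl
    intro α _
    rw [← Finset.sum_mul, ← main_coeff l ν hl hν c hc (fun i => (α i : ℕ)) t]
    congr 1
    apply Finset.sum_congr_of_eq_on_inter
    · intro μ _ h2
      have : HQ t m (fun _ => 0) μ (fun i => (α i : ℕ)) = 0 := by
        by_contra hne
        exact h2 (HQ_support _ _ _ _ _ hne)
      rw [this, mul_zero]
    · intro μ h2 h3
      have h4 := CQ_prop m _ μ isSig_zero _ h2
      have : c μ l = 0 := by
        by_contra hne
        exact h3 (hmem μ h4.1 h4.2 hne)
      rw [this, map_zero, zero_mul]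
    · intro μ _ _
      rfl
  · intro μ hμ
    rw [Function.mem_support] at hμ
    obtain ⟨h1, h2⟩ := ite_ne_right_iff.1 hμ
    apply hmem μ h1.1 h1.2
    intro h0
    apply h2
    rw [h0, map_zero, zero_mul]

end
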